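/- Let ε > 0. There exists a non-decreasing unbounded function f : ℕ → ℕ such that for every ring R and every finite nonempty subset X ⊆ R, writing Z := X − X, at least one of the following holds: (i) |X + X + X·X| ≥ f(|X|)·|X|; (ii) there exist a subring R' of R and a two-sided ideal I of R' with I ⊆ R' ∩ (4Z + Z·4Z) (hence I ⊆ R' ∩ Z₃) such that R'/I is nilpotent (of class at most m for some m ∈ ℕ) and |Z₃ ∩ R'| ≥ |X|^{1−ε}. -/

import Mathlib

open Pointwise

universe u

/-- `iterX Z n` is `Zₙ` where `Z₀ = Z` and `Z_{n+1} = Z_n + Z_n + Z_n · Z_n`. -/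
def iterX {R : Type u} [NonUnitalRing R] (Z : Set R) : ℕ → Set R
  | 0 => Z
  | n + 1 => iterX Z n + iterX Z n + iterX Z n * iterX Z n

/-- `mulIter S n` is the set of (left-nested) products of `n+1` elements of `S`. -/
def mulIter {R : Type u} [NonUnitalRing R] (S : Set R) : ℕ → Set R
  | 0 => S
  | n + 1 => mulIter S n * S

/-- `S` is a subring of the ambient ring (as a set). -/
def IsSubringSet {R : Type u} [NonUnitalRing R] (S : Set R) : Prop :=
  (0 : R) ∈ S ∧ (∀ x ∈ S, ∀ y ∈ S, x + y ∈ S) ∧ (∀ x ∈ S, -x ∈ S) ∧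
    ∀ x ∈ S, ∀ y ∈ S, x * y ∈ S

/-- `I` is a two-sided ideal of the subring `S` (both given as sets). -/
def IsTwoSidedIdealIn {R : Type u} [NonUnitalRing R] (I S : Set R) : Prop :=
  I ⊆ S ∧ (0 : R) ∈ I ∧ (∀ x ∈ I, ∀ y ∈ I, x + y ∈ I) ∧ (∀ x ∈ I, -x ∈ I) ∧
    ∀ r ∈ S, ∀ x ∈ I, r * x ∈ I ∧ x * r ∈ I

universe v

section part1

/-- `A` is covered by `N` translates of `B`. -/
def Cov {G : Type u} [AddCommGroup G] (A B : Set G) (N : ℕ) : Prop :=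
  ∃ F : Finset G, F.card ≤ N ∧ ∀ a ∈ A, ∃ f ∈ F, a - f ∈ B

/-- `n`-fold sumset. -/
def ms {G : Type u} [AddCommGroup G] (Y : Set G) : ℕ → Set G
  | 0 => {0}
  | n + 1 => ms Y n + Y

section cov
variable {G : Type u} [AddCommGroup G]

lemma Cov.mono {A A' B B' : Set G} {N N' : ℕ} (h : Cov A B N) (hA : A' ⊆ A) (hB : B ⊆ B')
    (hN : N ≤ N') : Cov A' B' N' := by
  obtain ⟨F, hF, h⟩ := h
  refine ⟨F, hF.trans hN, fun a ha => ?_⟩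
  obtain ⟨f, hf, hh⟩ := h a (hA ha)
  exact ⟨f, hf, hB hh⟩

lemma Cov.refl (A : Set G) : Cov A A 1 := ⟨{0}, by simp, fun a ha => ⟨0, by simp, by simpa using ha⟩⟩

lemma Cov.add {A A' B B' : Set G} {N N' : ℕ} (h : Cov A B N) (h' : Cov A' B' N') :
    Cov (A + A') (B + B') (N * N') := by
  classical
  obtain ⟨F, hF, h⟩ := h
  obtain ⟨F', hF', h'⟩ := h'
  refine ⟨F + F', Finset.card_add_le.trans (Nat.mul_le_mul hF hF'), ?_⟩
  rintro _ ⟨a, ha, a', ha', rfl⟩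
  obtain ⟨f, hf, hh⟩ := h a ha
  obtain ⟨f', hf', hh'⟩ := h' a' ha'
  refine ⟨f + f', Finset.add_mem_add hf hf', ⟨_, hh, _, hh', ?_⟩⟩
  simp only []
  abel

lemma Cov.trans {A B C : Set G} {N M : ℕ} (h : Cov A B N) (h' : Cov B C M) :
    Cov A C (N * M) := by
  classical
  obtain ⟨F, hF, h⟩ := h
  obtain ⟨F', hF', h'⟩ := h'
  refine ⟨F + F', Finset.card_add_le.trans (Nat.mul_le_mul hF hF'), ?_⟩
  intro a ha
  obtain ⟨f, hf, hh⟩ := h a ha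
  obtain ⟨f', hf', hh'⟩ := h' _ hh
  refine ⟨f + f', Finset.add_mem_add hf hf', ?_⟩
  rwa [← sub_sub]

lemma Cov.neg {A B : Set G} {N : ℕ} (h : Cov A B N) : Cov (-A) (-B) N := by
  classical
  obtain ⟨F, hF, h⟩ := h
  refine ⟨-F, by simpa using hF, ?_⟩
  intro a ha
  obtain ⟨f, hf, hh⟩ := h _ ha
  refine ⟨-f, by simpa using hf, ?_⟩
  simp only [Set.mem_neg]
  convert hh using 1
  abel

lemma Cov.sub {A A' B B' : Set G} {N N' : ℕ} (h : Cov A B N) (h' : Cov A' B' N') :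
    Cov (A - A') (B - B') (N * N') := by
  rw [sub_eq_add_neg, sub_eq_add_neg]
  exact h.add h'.neg

lemma Cov.card {A B : Set G} {N : ℕ} (h : Cov A B N) (hB : B.Finite) :
    A.Finite ∧ A.ncard ≤ N * B.ncard := by
  classical
  obtain ⟨F, hF, h⟩ := h
  have hsub : A ⊆ (F : Set G) + B := fun a ha => by
    obtain ⟨f, hf, hh⟩ := h a ha
    exact ⟨f, hf, _, hh, by simp⟩
  have hfin : ((F : Set G) + B).Finite := F.finite_toSet.add hB
  refine ⟨hfin.subset hsub, (Set.ncard_le_ncard hsub hfin).trans ?_⟩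
  have : (F : Set G) + B = ((F + hB.toFinset : Finset G) : Set G) := by simp
  rw [this, Set.ncard_coe_finset]
  refine Finset.card_add_le.trans ?_
  rw [Set.ncard_eq_toFinset_card B hB]
  exact Nat.mul_le_mul_right _ hF

lemma Cov.inside {A B : Set G} {N : ℕ} (h : Cov A B N) :
    ∃ F : Finset G, F.card ≤ N ∧ (F : Set G) ⊆ A ∧ ∀ a ∈ A, ∃ f ∈ F, a - f ∈ B - B := by
  classical
  obtain ⟨F, hF, h⟩ := h
  let g : G → G := fun f => if hf : ∃ a ∈ A, a - f ∈ B then hf.choose else 0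
  have hg : ∀ f, (∃ a ∈ A, a - f ∈ B) → g f ∈ A ∧ g f - f ∈ B := by
    intro f hf
    simp only [g, dif_pos hf]
    exact hf.choose_spec
  refine ⟨(F.filter (fun f => ∃ a ∈ A, a - f ∈ B)).image g, ?_, ?_, ?_⟩
  · exact Finset.card_image_le.trans ((Finset.card_filter_le _ _).trans hF)
  · intro x hx
    simp only [Finset.coe_image, Set.mem_image, Finset.mem_coe, Finset.mem_filter] at hx
    obtain ⟨f, ⟨_, hf⟩, rfl⟩ := hx
    exact (hg f hf).1
  · intro a ha
    obtain ⟨f, hf, hh⟩ := h a ha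
    refine ⟨g f, Finset.mem_image_of_mem _ (Finset.mem_filter.2 ⟨hf, a, ha, hh⟩), ?_⟩
    exact ⟨_, hh, _, (hg f ⟨a, ha, hh⟩).2, by simp⟩

lemma Cov.biUnion {ι : Type*} {F : Finset ι} {A : ι → Set G} {B : Set G} {N : ℕ}
    (h : ∀ i ∈ F, Cov (A i) B N) : Cov (⋃ i ∈ F, A i) B (F.card * N) := by
  classical
  choose! E hE h using h
  refine ⟨F.biUnion E, Finset.card_biUnion_le_card_mul _ _ _ hE, ?_⟩
  intro a ha
  simp only [Set.mem_iUnion] at ha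
  obtain ⟨i, hi, ha⟩ := ha
  obtain ⟨f, hf, hh⟩ := h i hi a ha
  exact ⟨f, Finset.mem_biUnion.2 ⟨i, hi, hf⟩, hh⟩

lemma Cov.ruzsa {A B : Set G} {N : ℕ} (hA : A.Finite) (hB : B.Finite) (hB' : B.Nonempty)
    (h : (A + B).ncard ≤ N * B.ncard) : Cov A (B - B) N := by
  classical
  lift A to Finset G using hA
  lift B to Finset G using hB
  rw [← Finset.coe_add, Set.ncard_coe_finset, Set.ncard_coe_finset] at h
  obtain ⟨F, _, hF, hc⟩ := Finset.ruzsa_covering_add (K := (N : ℝ)) (A := A) (B := B)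
    (by simpa using hB') (by exact_mod_cast h)
  refine ⟨F, by exact_mod_cast hF, fun a ha => ?_⟩
  obtain ⟨f, hf, y, hy, rfl⟩ := Finset.mem_add.1 (hc ha)
  refine ⟨f, hf, ?_⟩
  rw [add_sub_cancel_left, ← Finset.coe_sub]
  exact hy

lemma zero_mem_ms {Y : Set G} (h0 : (0 : G) ∈ Y) (n : ℕ) : (0 : G) ∈ ms Y n := by
  induction n with
  | zero => simp [ms]
  | succ n ih => exact ⟨0, ih, 0, h0, by simp⟩

lemma ms_succ_mono {Y : Set G} (h0 : (0 : G) ∈ Y) (n : ℕ) : ms Y n ⊆ ms Y (n + 1) :=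
  fun a ha => ⟨a, ha, 0, h0, by simp⟩

lemma ms_mono {Y : Set G} (h0 : (0 : G) ∈ Y) {n m : ℕ} (h : n ≤ m) : ms Y n ⊆ ms Y m :=
  monotone_nat_of_le_succ (f := ms Y) (ms_succ_mono h0) h

lemma ms_mono_left {Y Y' : Set G} (h : Y ⊆ Y') (n : ℕ) : ms Y n ⊆ ms Y' n := by
  induction n with
  | zero => exact subset_rfl
  | succ n ih => exact Set.add_subset_add ih h

lemma ms_one (Y : Set G) : ms Y 1 = Y := by simp [ms]

lemma ms_add (Y : Set G) (a b : ℕ) : ms Y (a + b) = ms Y a + ms Y b := by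
  induction b with
  | zero => simp [ms]
  | succ b ih => rw [← add_assoc, ms, ih, ms, add_assoc]

lemma ms_two (Y : Set G) : ms Y 2 = Y + Y := by simp [ms]

lemma ms_mul (Y : Set G) (a b : ℕ) : ms (ms Y a) b = ms Y (a * b) := by
  induction b with
  | zero => simp [ms]
  | succ b ih => rw [ms, ih, Nat.mul_succ, ms_add]

lemma ms_neg {Y : Set G} (hs : ∀ y ∈ Y, -y ∈ Y) (n : ℕ) : ∀ y ∈ ms Y n, -y ∈ ms Y n := by
  induction n with
  | zero => simp [ms]
  | succ n ih =>
    rintro _ ⟨a, ha, y, hy, rfl⟩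
    exact ⟨-a, ih a ha, -y, hs y hy, by simp only []; abel⟩

lemma ms_finite {Y : Set G} (hY : Y.Finite) (n : ℕ) : (ms Y n).Finite := by
  induction n with
  | zero => exact Set.finite_singleton _
  | succ n ih => exact ih.add hY

lemma sum_mem_ms {Y : Set G} {ι : Type*} (s : Finset ι) (f : ι → G) (h : ∀ i ∈ s, f i ∈ Y) :
    ∑ i ∈ s, f i ∈ ms Y s.card := by
  classical
  induction s using Finset.induction_on with
  | empty => simp [ms]
  | insert a s ha ih =>
    rw [Finset.sum_insert ha, Finset.card_insert_of_notMem ha, add_comm (f a)]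
    exact ⟨_, ih (fun i hi => h i (Finset.mem_insert_of_mem hi)), _, h a (by simp), rfl⟩

lemma nsmul_mem_ms {Y : Set G} {y : G} (hy : y ∈ Y) (n : ℕ) : n • y ∈ ms Y n := by
  induction n with
  | zero => simp [ms]
  | succ n ih => rw [succ_nsmul]; exact ⟨_, ih, _, hy, rfl⟩

lemma ms_cov_poly {Y : Set G} {L : ℕ} (hc : Cov (Y + Y) Y L) (j : ℕ) :
    Cov (ms Y (j + 1)) Y ((j + 1) ^ L) := by
  classical
  obtain ⟨F, hF, h⟩ := hc
  have key : ∀ j : ℕ, ∀ a ∈ ms Y (j + 1), ∃ c : F → ℕ, (∀ f, c f ≤ j) ∧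
      a - ∑ f : F, c f • (f : G) ∈ Y := by
    intro j
    induction j with
    | zero =>
      intro a ha
      rw [ms_one] at ha
      exact ⟨fun _ => 0, by simp, by simpa using ha⟩
    | succ j ih =>
      rintro _ ⟨a, ha, y, hy, rfl⟩
      obtain ⟨c, hc, hy'⟩ := ih a ha
      obtain ⟨f, hf, hh⟩ := h _ ⟨_, hy', _, hy, rfl⟩
      refine ⟨fun g => c g + if g = ⟨f, hf⟩ then 1 else 0, ?_, ?_⟩
      · intro g
        simp only []
        split_ifs
        · have := hc g; omega
        · have := hc g; omega
      · simp only [add_smul, Finset.sum_add_distrib, ite_smul, one_smul, zero_smul,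
          Finset.sum_ite_eq', Finset.mem_univ, if_true]
        convert hh using 1
        simp only []
        abel
  refine ⟨(Finset.univ : Finset (F → Fin (j + 1))).image
    (fun c => ∑ f : F, (c f : ℕ) • (f : G)), ?_, ?_⟩
  · refine Finset.card_image_le.trans ?_
    simp only [Finset.card_univ, Fintype.card_fun, Fintype.card_fin, Fintype.card_coe]
    exact Nat.pow_le_pow_right (by omega) hF
  · intro a ha
    obtain ⟨c, hc, hh⟩ := key j a ha
    refine ⟨_, Finset.mem_image_of_mem _ (Finset.mem_univ
      (fun f => ⟨c f, Nat.lt_succ_of_le (hc f)⟩)), hh⟩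

end cov

end part1

section part2

section iter
variable {R : Type u} [NonUnitalRing R]

lemma iterX_zero_mem {Z : Set R} (h0 : (0 : R) ∈ Z) (n : ℕ) : (0 : R) ∈ iterX Z n := by
  induction n with
  | zero => exact h0
  | succ n ih => exact ⟨0, ⟨0, ih, 0, ih, by simp⟩, 0, ⟨0, ih, 0, ih, by simp⟩, by simp⟩

lemma iterX_add {Z : Set R} (h0 : (0 : R) ∈ Z) (n : ℕ) {a b : R} (ha : a ∈ iterX Z n)
    (hb : b ∈ iterX Z n) : a + b ∈ iterX Z (n + 1) := by
  have h := iterX_zero_mem h0 n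
  exact ⟨a + b, ⟨a, ha, b, hb, rfl⟩, 0, ⟨0, h, 0, h, by simp⟩, by simp⟩

lemma iterX_mul {Z : Set R} (h0 : (0 : R) ∈ Z) (n : ℕ) {a b : R} (ha : a ∈ iterX Z n)
    (hb : b ∈ iterX Z n) : a * b ∈ iterX Z (n + 1) := by
  have h := iterX_zero_mem h0 n
  exact ⟨0, ⟨0, h, 0, h, by simp⟩, a * b, ⟨a, ha, b, hb, rfl⟩, by simp⟩

lemma iterX_mono {Z : Set R} (h0 : (0 : R) ∈ Z) {n m : ℕ} (h : n ≤ m) :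
    iterX Z n ⊆ iterX Z m := by
  refine monotone_nat_of_le_succ (f := iterX Z) (fun n a ha => ?_) h
  simpa using iterX_add h0 n ha (iterX_zero_mem h0 n)

lemma iterX_neg {Z : Set R} (hs : ∀ z ∈ Z, -z ∈ Z) (n : ℕ) :
    ∀ z ∈ iterX Z n, -z ∈ iterX Z n := by
  induction n with
  | zero => exact hs
  | succ n ih =>
    rintro _ ⟨_, ⟨a, ha, b, hb, rfl⟩, _, ⟨c, hc, d, hd, rfl⟩, rfl⟩
    refine ⟨_, ⟨-a, ih a ha, -b, ih b hb, rfl⟩, _, ⟨-c, ih c hc, d, hd, rfl⟩, ?_⟩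
    simp only [neg_mul]
    abel

lemma iterX_finite {Z : Set R} (hZ : Z.Finite) (n : ℕ) : (iterX Z n).Finite := by
  induction n with
  | zero => exact hZ
  | succ n ih => exact (ih.add ih).add (ih.mul ih)

lemma ms_iterX {Z : Set R} (h0 : (0 : R) ∈ Z) (n k : ℕ) : ms (iterX Z n) k ⊆ iterX Z (n + k) := by
  induction k with
  | zero => intro a ha; simp only [ms, Set.mem_singleton_iff] at ha; subst ha
            exact iterX_zero_mem h0 _
  | succ k ih =>
    rintro _ ⟨a, ha, b, hb, rfl⟩
    exact iterX_add h0 (n + k) (ih ha) (iterX_mono h0 (by omega) hb)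

lemma ms_le_iterX {Z : Set R} (h0 : (0 : R) ∈ Z) {k n : ℕ} (h : k ≤ n) : ms Z k ⊆ iterX Z n := by
  have := ms_iterX h0 0 k
  exact this.trans (iterX_mono h0 (by omega))

lemma Cov.mul_right {A B : Set R} {N : ℕ} (h : Cov A B N) (t : R) :
    Cov (A * {t}) (B * {t}) N := by
  classical
  obtain ⟨F, hF, h⟩ := h
  refine ⟨F.image (· * t), Finset.card_image_le.trans hF, ?_⟩
  rintro _ ⟨a, ha, _, rfl, rfl⟩
  obtain ⟨f, hf, hh⟩ := h a ha
  exact ⟨_, Finset.mem_image_of_mem _ hf, _, hh, _, rfl, by simp [sub_mul]⟩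

lemma Cov.mul_left {A B : Set R} {N : ℕ} (h : Cov A B N) (t : R) :
    Cov ({t} * A) ({t} * B) N := by
  classical
  obtain ⟨F, hF, h⟩ := h
  refine ⟨F.image (t * ·), Finset.card_image_le.trans hF, ?_⟩
  rintro _ ⟨_, rfl, a, ha, rfl⟩
  obtain ⟨f, hf, hh⟩ := h a ha
  exact ⟨_, Finset.mem_image_of_mem _ hf, _, rfl, _, hh, by simp [mul_sub]⟩

/-- The working hypothesis extracted from small `X + X + X * X`. -/
structure Good (X : Set R) (L : ℕ) : Prop where
  fin : X.Finite
  ne : X.Nonempty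
  mulc : Cov (X * X) (X - X) L
  addc : Cov ((X - X) + (X - X)) (X - X) L
  cardZ : (X - X).ncard ≤ L * X.ncard

lemma Good.zero {X : Set R} {L : ℕ} (h : Good X L) : (0 : R) ∈ X - X := by
  obtain ⟨x, hx⟩ := h.ne
  exact ⟨x, hx, x, hx, by simp⟩

lemma symm_sub {G : Type u} [AddCommGroup G] {X : Set G} : ∀ z ∈ X - X, -z ∈ X - X := by
  rintro _ ⟨x, hx, y, hy, rfl⟩
  exact ⟨y, hy, x, hx, by simp⟩

lemma neg_sub_set {G : Type u} [AddCommGroup G] {X : Set G} : -(X - X) = X - X := neg_sub X X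

lemma subZ_eq {G : Type u} [AddCommGroup G] {X : Set G} : (X - X) - (X - X) = (X - X) + (X - X) := by
  rw [sub_eq_add_neg (X - X) (X - X), neg_sub_set]

lemma good_of_small {X : Set R} {K : ℕ} (hX : X.Finite) (hne : X.Nonempty)
    (h : (X + X + X * X).ncard ≤ K * X.ncard) : Good X (K ^ 5) := by
  classical
  have hfin : (X + X + X * X).Finite := (hX.add hX).add (hX.mul hX)
  obtain ⟨x0, hx0⟩ := hne
  have hpos : 0 < X.ncard := (Set.ncard_pos hX).2 ⟨x0, hx0⟩
  have h1 : (X + X).ncard ≤ K * X.ncard := by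
    refine le_trans ?_ h
    have : ((X + X) + {x0 * x0}).ncard = (X + X).ncard := by
      rw [Set.add_singleton]
      exact Set.ncard_image_of_injective _ (add_left_injective _)
    rw [← this]
    refine Set.ncard_le_ncard (Set.add_subset_add_left ?_) hfin
    rintro _ rfl
    exact ⟨x0, hx0, x0, hx0, rfl⟩
  have h2 : (X * X + X).ncard ≤ K * X.ncard := by
    refine le_trans ?_ h
    have : ((X * X + X) + {x0}).ncard = (X * X + X).ncard := by
      rw [Set.add_singleton]
      exact Set.ncard_image_of_injective _ (add_left_injective _)
    rw [← this]
    refine Set.ncard_le_ncard ?_ hfin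
    rintro _ ⟨_, ⟨a, ha, b, hb, rfl⟩, c, hc, rfl⟩
    rw [Set.mem_singleton_iff] at hc; subst hc
    exact ⟨b + c, ⟨b, hb, c, hx0, rfl⟩, a, ha, by simp only []; abel⟩
  have hK : 1 ≤ K := by
    by_contra hK
    have hK : K = 0 := by omega
    subst hK
    have : (X + X).ncard = 0 := by omega
    rw [Set.ncard_eq_zero (hX.add hX)] at this
    have h3 : x0 + x0 ∈ X + X := ⟨x0, hx0, x0, hx0, rfl⟩
    rw [this] at h3; exact h3
  have hpl : ∀ m n : ℕ, ((m • hX.toFinset - n • hX.toFinset).card) ≤ K ^ (m + n) * X.ncard := by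
    intro m n
    have h3 := Finset.pluennecke_ruzsa_inequality_nsmul_sub_nsmul_add (A := hX.toFinset)
      (by simpa using ⟨x0, hx0⟩) hX.toFinset m n
    have hc : hX.toFinset.card = X.ncard := (Set.ncard_eq_toFinset_card X hX).symm
    have hc2 : (hX.toFinset + hX.toFinset).card = (X + X).ncard := by
      rw [← Set.ncard_coe_finset]; simp
    have h4 : ((hX.toFinset + hX.toFinset).card / hX.toFinset.card : ℚ≥0) ≤ K := by
      rw [hc, hc2, div_le_iff₀ (by exact_mod_cast hpos)]
      exact_mod_cast h1
    have h5 : ((m • hX.toFinset - n • hX.toFinset).card : ℚ≥0) ≤ (K : ℚ≥0) ^ (m + n) * X.ncard := by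
      refine h3.trans ?_
      rw [hc] at h4 ⊢
      gcongr
    exact_mod_cast h5
  have hK5 : ∀ {a}, a ≤ 5 → K ^ a ≤ K ^ 5 := fun h => Nat.pow_le_pow_right hK h
  refine ⟨hX, ⟨x0, hx0⟩, ?_, ?_, ?_⟩
  · exact (Cov.ruzsa (hX.mul hX) hX ⟨x0, hx0⟩ h2).mono subset_rfl subset_rfl
      (by simpa using hK5 (a := 1) (by norm_num))
  · refine Cov.ruzsa ((hX.sub hX).add (hX.sub hX)) hX ⟨x0, hx0⟩ ?_
    have h3 := hpl 3 2
    rw [← Set.ncard_coe_finset] at h3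
    have : ((X - X) + (X - X)) + X = ((3 • hX.toFinset - 2 • hX.toFinset : Finset R) : Set R) := by
      rw [succ_nsmul, two_nsmul]
      have hh : ∀ A B : Set R, A + B + (A + B) + A = A + A + A + (B + B) := fun A B => by ac_rfl
      simp only [Finset.coe_sub, Finset.coe_add, Set.Finite.coe_toFinset]
      simp only [sub_eq_add_neg, neg_add]
      exact hh X (-X)
    rw [this]
    exact h3
  · have h3 := hpl 1 1
    rw [← Set.ncard_coe_finset] at h3
    simp only [one_nsmul, Finset.coe_sub, Set.Finite.coe_toFinset] at h3
    exact h3.trans (Nat.mul_le_mul_right _ (hK5 (by norm_num)))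

/-- Cover of a multiple sum of `Z` by `Z`. -/
lemma Good.cov_ms {X : Set R} {L : ℕ} (h : Good X L) (n : ℕ) :
    Cov (ms (X - X) (n + 1)) (X - X) ((n + 1) ^ L) := ms_cov_poly h.addc n

lemma Good.add2 {X A B : Set R} {L M N : ℕ} (h : Good X L) (hA : Cov A (X - X) M)
    (hB : Cov B (X - X) N) : Cov (A + B) (X - X) (M * N * L) :=
  (hA.add hB).trans h.addc

lemma Good.sub2 {X A B : Set R} {L M N : ℕ} (h : Good X L) (hA : Cov A (X - X) M)
    (hB : Cov B (X - X) N) : Cov (A - B) (X - X) (M * N * L) :=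
  (hA.sub hB).trans (by rw [subZ_eq]; exact h.addc)

lemma Good.right {X : Set R} {L M : ℕ} (h : Good X L) {t : R} (hA : Cov (X * {t}) (X - X) M) :
    Cov ((X - X) * {t}) (X - X) (M * M * L) :=
  (h.sub2 hA hA).mono (by
    rintro _ ⟨_, ⟨x, hx, y, hy, rfl⟩, _, rfl, rfl⟩
    exact ⟨_, ⟨x, hx, _, rfl, rfl⟩, _, ⟨y, hy, _, rfl, rfl⟩, by simp [sub_mul]⟩) subset_rfl le_rfl

lemma Good.left {X : Set R} {L M : ℕ} (h : Good X L) {t : R} (hA : Cov ({t} * X) (X - X) M) :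
    Cov ({t} * (X - X)) (X - X) (M * M * L) :=
  (h.sub2 hA hA).mono (by
    rintro _ ⟨_, rfl, _, ⟨x, hx, y, hy, rfl⟩, rfl⟩
    exact ⟨_, ⟨_, rfl, x, hx, rfl⟩, _, ⟨_, rfl, y, hy, rfl⟩, by simp [mul_sub]⟩) subset_rfl le_rfl

lemma Good.cov_ZZ {X : Set R} {L : ℕ} (h : Good X L) : Cov ((X - X) * (X - X)) (X - X)
    ((L * L * L) * (L * L * L) * L) := by
  refine (h.sub2 (h.sub2 h.mulc h.mulc) (h.sub2 h.mulc h.mulc)).mono ?_ subset_rfl le_rfl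
  rintro _ ⟨_, ⟨a, ha, b, hb, rfl⟩, _, ⟨c, hc, d, hd, rfl⟩, rfl⟩
  refine ⟨_, ⟨_, ⟨a, ha, c, hc, rfl⟩, _, ⟨b, hb, c, hc, rfl⟩, rfl⟩, _,
    ⟨_, ⟨a, ha, d, hd, rfl⟩, _, ⟨b, hb, d, hd, rfl⟩, rfl⟩, ?_⟩
  simp only [sub_mul, mul_sub]

end iter

lemma iter_cov (L : ℕ) (n : ℕ) : ∃ M : ℕ, ∀ (R : Type u) [NonUnitalRing R] (X : Set R),
    Good X L → Cov (iterX (X - X) n) (X - X) M ∧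
      ∀ t ∈ iterX (X - X) n, Cov (X * {t}) (X - X) M ∧ Cov ({t} * X) (X - X) M := by
  induction n with
  | zero =>
    refine ⟨1 + L * L * L, fun R _ X h => ⟨(Cov.refl _).mono subset_rfl subset_rfl (by omega), ?_⟩⟩
    rintro _ ⟨x, hx, y, hy, rfl⟩
    constructor
    · refine (h.sub2 h.mulc h.mulc).mono ?_ subset_rfl (by omega)
      rintro _ ⟨a, ha, _, rfl, rfl⟩
      exact ⟨_, ⟨a, ha, x, hx, rfl⟩, _, ⟨a, ha, y, hy, rfl⟩, by simp [mul_sub]⟩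
    · refine (h.sub2 h.mulc h.mulc).mono ?_ subset_rfl (by omega)
      rintro _ ⟨_, rfl, a, ha, rfl⟩
      exact ⟨_, ⟨x, hx, a, ha, rfl⟩, _, ⟨y, hy, a, ha, rfl⟩, by simp [sub_mul]⟩
  | succ n ih =>
    obtain ⟨M, ih⟩ := ih
    -- constants
    obtain ⟨a, ha⟩ : ∃ a, a = M * (M * M * L) := ⟨_, rfl⟩
    obtain ⟨b, hb⟩ : ∃ b, b = (M * M * L) * a * L := ⟨_, rfl⟩
    obtain ⟨d, hd⟩ : ∃ d, d = (M * M * L) * (M * M * L) * L := ⟨_, rfl⟩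
    obtain ⟨e, he⟩ : ∃ e, e = (L * L * L) * (L * L * L) * L := ⟨_, rfl⟩
    obtain ⟨e4, he4⟩ : ∃ e4, e4 = (e * e * L) * (e * e * L) * L := ⟨_, rfl⟩
    obtain ⟨p, hp⟩ : ∃ p, p = M * (M * (d * d * L * e4 * L)) := ⟨_, rfl⟩
    refine ⟨b + M * M * L * p * L, fun R _ X h => ⟨?_, ?_⟩⟩
    · obtain ⟨hW, ht⟩ := ih R X h
      obtain ⟨F, hF, hFW, hcov⟩ := hW.inside
      rw [subZ_eq] at hcov
      have hr : ∀ f ∈ F, Cov (((X - X) + (X - X)) * {f}) (X - X) d := fun f hf => by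
        have h1 := h.right (ht f (hFW hf)).1
        refine (hd ▸ h.add2 h1 h1).mono ?_ subset_rfl le_rfl
        rintro _ ⟨_, ⟨x, hx, y, hy, rfl⟩, _, rfl, rfl⟩
        exact ⟨_, ⟨x, hx, _, rfl, rfl⟩, _, ⟨y, hy, _, rfl, rfl⟩, by simp [add_mul]⟩
      have hl : ∀ f ∈ F, Cov ({f} * ((X - X) + (X - X))) (X - X) d := fun f hf => by
        have h1 := h.left (ht f (hFW hf)).2
        refine (hd ▸ h.add2 h1 h1).mono ?_ subset_rfl le_rfl
        rintro _ ⟨_, rfl, _, ⟨x, hx, y, hy, rfl⟩, rfl⟩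
        exact ⟨_, ⟨_, rfl, x, hx, rfl⟩, _, ⟨_, rfl, y, hy, rfl⟩, by simp [mul_add]⟩
      have hzz : Cov (((X - X) + (X - X)) * ((X - X) + (X - X))) (X - X) e4 := by
        have h1 := he ▸ h.cov_ZZ
        refine (he4 ▸ h.add2 (h.add2 h1 h1) (h.add2 h1 h1)).mono ?_ subset_rfl le_rfl
        rintro _ ⟨_, ⟨x, hx, y, hy, rfl⟩, _, ⟨z, hz, w, hw, rfl⟩, rfl⟩
        refine ⟨_, ⟨_, ⟨x, hx, z, hz, rfl⟩, _, ⟨y, hy, z, hz, rfl⟩, rfl⟩, _,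
          ⟨_, ⟨x, hx, w, hw, rfl⟩, _, ⟨y, hy, w, hw, rfl⟩, rfl⟩, by simp only [add_mul, mul_add]⟩
      have hWW : Cov (iterX (X - X) n * iterX (X - X) n) (X - X) p := by
        have h1 : ∀ f ∈ F, ∀ g ∈ F, Cov ({f * g} + (({f} * ((X - X) + (X - X)) +
            ((X - X) + (X - X)) * {g}) + ((X - X) + (X - X)) * ((X - X) + (X - X))))
            (X - X) (d * d * L * e4 * L) := by
          intro f hf g hg
          have h2 := h.add2 (h.add2 (hl f hf) (hr g hg)) hzz
          obtain ⟨E, hE, h3⟩ := h2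
          classical
          refine ⟨E.image (f * g + ·), Finset.card_image_le.trans hE, ?_⟩
          rintro _ ⟨_, rfl, v, hv, rfl⟩
          obtain ⟨e, he, h4⟩ := h3 v hv
          exact ⟨_, Finset.mem_image_of_mem _ he, by simpa using h4⟩
        have h2 := Cov.biUnion (fun f hf => Cov.biUnion (F := F) (h1 f hf))
        refine h2.mono ?_ subset_rfl ?_
        · rintro _ ⟨v, hv, w, hw, rfl⟩
          obtain ⟨f, hf, hfv⟩ := hcov v hv
          obtain ⟨g, hg, hgw⟩ := hcov w hw
          simp only [Set.mem_iUnion]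
          refine ⟨f, hf, g, hg, _, rfl, _, ⟨_, ⟨_, ⟨_, rfl, _, hgw, rfl⟩, _, ⟨_, hfv, _, rfl, rfl⟩,
            rfl⟩, _, ⟨_, hfv, _, hgw, rfl⟩, rfl⟩, ?_⟩
          simp only [mul_sub, sub_mul]
          abel
        · rw [hp]; gcongr
      refine (h.add2 (h.add2 hW hW) hWW).mono ?_ subset_rfl (by omega)
      exact subset_rfl
    · obtain ⟨hW, ht⟩ := ih R X h
      rintro _ ⟨_, ⟨w1, h1, w2, h2, rfl⟩, _, ⟨w3, h3, w4, h4, rfl⟩, rfl⟩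
      constructor
      · have h5 := ha ▸ ((ht w3 h3).1.mul_right w4).trans (h.right (ht w4 h4).1)
        refine (hb ▸ h.add2 (h.add2 (ht w1 h1).1 (ht w2 h2).1) h5).mono ?_ subset_rfl (by omega)
        rintro _ ⟨x, hx, _, rfl, rfl⟩
        refine ⟨_, ⟨_, ⟨x, hx, _, rfl, rfl⟩, _, ⟨x, hx, _, rfl, rfl⟩, rfl⟩, _,
          ⟨_, ⟨x, hx, _, rfl, rfl⟩, _, rfl, rfl⟩, by simp only [mul_add, mul_assoc]⟩
      · have h5 := ha ▸ ((ht w4 h4).2.mul_left w3).trans (h.left (ht w3 h3).2)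
        refine (hb ▸ h.add2 (h.add2 (ht w1 h1).2 (ht w2 h2).2) h5).mono ?_ subset_rfl (by omega)
        rintro _ ⟨_, rfl, x, hx, rfl⟩
        refine ⟨_, ⟨_, ⟨_, rfl, x, hx, rfl⟩, _, ⟨_, rfl, x, hx, rfl⟩, rfl⟩, _,
          ⟨_, rfl, _, ⟨_, rfl, x, hx, rfl⟩, rfl⟩, by simp only [add_mul, mul_assoc]⟩

end part2

section part3

lemma poly_lt_exp (a b L : ℕ) (c r : ℝ) (hc : 0 ≤ c) (hr : 1 < r) :
    ∃ J : ℕ, ∀ j : ℕ, J ≤ j → c * ((a * j + b : ℕ) : ℝ) ^ L < r ^ j := by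
  have h := tendsto_pow_const_div_const_pow_of_one_lt L hr
  have hpos : 0 < 1 / (c * ((a + b : ℕ) : ℝ) ^ L + 1) := by positivity
  have h2 := (h.eventually (gt_mem_nhds hpos)).and (Filter.eventually_ge_atTop 1)
  obtain ⟨J, hJ⟩ := Filter.eventually_atTop.1 h2
  refine ⟨J, fun j hj => ?_⟩
  obtain ⟨h3, h4⟩ := hJ j hj
  have hrj : 0 < r ^ j := by positivity
  have h5 : ((a * j + b : ℕ) : ℝ) ≤ ((a + b : ℕ) : ℝ) * j := by
    have : a * j + b ≤ (a + b) * j := by nlinarith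
    exact_mod_cast this
  have h6 : c * ((a * j + b : ℕ) : ℝ) ^ L ≤ (c * ((a + b : ℕ) : ℝ) ^ L) * (j : ℝ) ^ L := by
    rw [mul_assoc, ← mul_pow]
    gcongr
  have h7 : (0 : ℝ) < (j : ℝ) ^ L := by
    have : (0 : ℝ) < j := by exact_mod_cast h4
    positivity
  rw [div_lt_div_iff₀ hrj (by positivity)] at h3
  nlinarith

/-- Existence of a subgroup controlling all subgroups inside `ms Y k`. -/
lemma exists_T (L k : ℕ) : ∃ κ : ℕ, ∀ (G : Type u) [AddCommGroup G] (Y : Set G), Y.Finite →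
    (0 : G) ∈ Y → (∀ y ∈ Y, -y ∈ Y) → Cov (Y + Y) Y L →
    ∃ T : AddSubgroup G, (T : Set G) ⊆ ms Y κ ∧
      ∀ H : AddSubgroup G, (H : Set G) ⊆ ms Y k → H ≤ T := by
  obtain ⟨k', hk'⟩ : ∃ k', k' = max k 4 := ⟨_, rfl⟩
  obtain ⟨J, hJ⟩ := poly_lt_exp k' 1 L 1 2 (by norm_num) (by norm_num)
  refine ⟨J * k' + 2, fun G _ Y hY h0 hs hc => ?_⟩
  have hYpos : 0 < Y.ncard := (Set.ncard_pos hY).2 ⟨0, h0⟩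
  let good : ℕ → AddSubgroup G → Prop := fun j S =>
    (S : Set G) ⊆ ms Y (j * k') ∧ 2 ^ j * Y.ncard ≤ ((S : Set G) + Y).ncard
  have hlt : ∀ j S, good j S → j < J := by
    intro j S ⟨h1, h2⟩
    by_contra hj
    push Not at hj
    have h3 := hJ j hj
    have h4 : (S : Set G) + Y ⊆ ms Y (j * k' + 1) := Set.add_subset_add_right h1
    have h5 := ((ms_cov_poly hc (j * k')).card hY)
    have h6 := (Set.ncard_le_ncard h4 h5.1).trans h5.2
    have h7 := Nat.le_of_mul_le_mul_right (h2.trans h6) hYpos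
    have h8 : ((2 : ℝ) ^ j) ≤ ((k' * j + 1 : ℕ) : ℝ) ^ L := by
      rw [mul_comm k' j]; exact_mod_cast h7
    linarith
  obtain ⟨j, S, hS, hmax⟩ : ∃ j S, good j S ∧ ∀ S', ¬ good (j + 1) S' := by
    by_contra hcon
    push Not at hcon
    have : ∀ j, ∃ S, good j S := by
      intro j
      induction j with
      | zero => exact ⟨⊥, by simp [good, ms]⟩
      | succ j ih => obtain ⟨S, hS⟩ := ih; exact hcon j S hS
    obtain ⟨S, hS⟩ := this J
    exact lt_irrefl _ (hlt J S hS)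
  have hj := hlt j S hS
  obtain ⟨hS1, hS2⟩ := hS
  have claim : ∀ H : AddSubgroup G, S ≤ H → (H : Set G) ⊆ (S : Set G) + ms Y k' →
      (H : Set G) ⊆ (S : Set G) + ms Y 2 := by
    intro H hSH hH g hg
    by_contra hgn
    apply hmax H
    have hHm : (H : Set G) ⊆ ms Y ((j + 1) * k') := by
      refine hH.trans ?_
      rw [Nat.add_mul, one_mul, ms_add]
      exact Set.add_subset_add_right hS1
    refine ⟨hHm, ?_⟩
    have hHfin : ((H : Set G) + Y).Finite := ((ms_finite hY _).subset hHm).add hY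
    have hA : (S : Set G) + Y ⊆ (H : Set G) + Y := Set.add_subset_add_right hSH
    have hB : (g + ·) '' ((S : Set G) + Y) ⊆ (H : Set G) + Y := by
      rintro _ ⟨_, ⟨s, hs, y, hy, rfl⟩, rfl⟩
      exact ⟨g + s, H.add_mem hg (hSH hs), y, hy, by simp only []; abel⟩
    have hdis : Disjoint ((S : Set G) + Y) ((g + ·) '' ((S : Set G) + Y)) := by
      rw [Set.disjoint_left]
      rintro _ ⟨s, hs', y, hy, rfl⟩ ⟨_, ⟨s', hs'', y', hy', rfl⟩, he⟩
      apply hgn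
      refine ⟨s - s', S.sub_mem hs' hs'', y - y', ?_, ?_⟩
      · rw [ms_two]
        exact ⟨y, hy, -y', hs y' hy', by simp only []; abel⟩
      · simp only [] at he ⊢
        have : g = s + y - (s' + y') := by rw [← he]; abel
        rw [this]; abel
    have hU := Set.ncard_le_ncard (Set.union_subset hA hB) hHfin
    rw [Set.ncard_union_eq hdis (hHfin.subset hA) (hHfin.subset hB),
      Set.ncard_image_of_injective _ (add_right_injective g)] at hU
    rw [pow_succ]
    nlinarith
  let fam : AddSubgroup G → Prop := fun H => S ≤ H ∧ (H : Set G) ⊆ (S : Set G) + ms Y 2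
  have hSfin : (S : Set G).Finite := (ms_finite hY _).subset hS1
  have hfamfin : ((S : Set G) + ms Y 2).Finite := hSfin.add (ms_finite hY 2)
  have hfamS : fam S := ⟨le_rfl, fun s hs => ⟨s, hs, 0, zero_mem_ms h0 2, by simp⟩⟩
  have hsup : ∀ H1 H2, fam H1 → fam H2 → fam (H1 ⊔ H2) := by
    intro H1 H2 h1 h2
    have hle : S ≤ H1 ⊔ H2 := h1.1.trans le_sup_left
    refine ⟨hle, claim _ hle ?_⟩
    intro x hx
    obtain ⟨a, ha, b, hb, rfl⟩ := AddSubgroup.mem_sup.1 hx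
    obtain ⟨s, hs, y, hy, rfl⟩ := h1.2 ha
    obtain ⟨s', hs', y', hy', rfl⟩ := h2.2 hb
    refine ⟨s + s', S.add_mem hs hs', y + y', ?_, ?_⟩
    · refine ms_mono h0 (n := 2 + 2) (by rw [hk']; exact le_max_right _ _) ?_
      rw [ms_add]; exact ⟨y, hy, y', hy', rfl⟩
    · simp only []; abel
  obtain ⟨T, hT, hTmax⟩ : ∃ T, fam T ∧ ∀ H, fam H → (H : Set G).ncard ≤ (T : Set G).ncard := by
    let A : Set ℕ := {n | ∃ H, fam H ∧ (H : Set G).ncard = n}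
    have hbdd : BddAbove A := ⟨((S : Set G) + ms Y 2).ncard, by
      rintro _ ⟨H, hH, rfl⟩
      exact Set.ncard_le_ncard hH.2 hfamfin⟩
    obtain ⟨T, hT, hTn⟩ := Nat.sSup_mem (s := A) ⟨_, S, hfamS, rfl⟩ hbdd
    refine ⟨T, hT, fun H hH => ?_⟩
    rw [hTn]
    exact le_csSup hbdd ⟨H, hH, rfl⟩
  refine ⟨T, ?_, ?_⟩
  · refine hT.2.trans ((Set.add_subset_add_right hS1).trans ?_)
    rw [← ms_add]
    exact ms_mono h0 (by have := Nat.mul_le_mul_right k' hj.le; omega)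
  · intro H hH
    have hHS : fam (H ⊔ S) := by
      refine ⟨le_sup_right, claim _ le_sup_right ?_⟩
      intro x hx
      obtain ⟨a, ha, b, hb, rfl⟩ := AddSubgroup.mem_sup.1 hx
      exact ⟨b, hb, a, ms_mono h0 (by rw [hk']; exact le_max_left _ _) (hH ha), by simp only []; abel⟩
    have h1 := hsup T _ hT hHS
    have h2 := hTmax _ h1
    have h3 : (T : Set G) ⊆ ((T ⊔ (H ⊔ S) : AddSubgroup G) : Set G) := by
      have : T ≤ T ⊔ (H ⊔ S) := le_sup_left
      exact this
    have h4 := Set.eq_of_subset_of_ncard_le h3 h2 (hfamfin.subset h1.2)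
    have h5 : T = T ⊔ (H ⊔ S) := SetLike.coe_injective h4
    rw [h5]
    exact le_sup_left.trans le_sup_right

end part3

section part4

section fourier
variable {G : Type u} [AddCommGroup G] [Finite G]

lemma exists_zero_of_sum {ι : Type*} (s : Finset ι) (v : ι → G)
    (h : ∑ ψ : AddChar G ℂ, ∑ i ∈ s, ψ (v i) ≠ 0) : ∃ i ∈ s, v i = 0 := by
  by_contra hcon
  push Not at hcon
  apply h
  rw [Finset.sum_comm]
  exact Finset.sum_eq_zero fun i hi => AddChar.sum_apply_eq_zero_iff_ne_zero.2 (hcon i hi)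

lemma parseval (A : Finset G) :
    ∑ ψ : AddChar G ℂ, ‖∑ a ∈ A, ψ a‖ ^ 2 = (A.card : ℝ) * Nat.card G := by
  classical
  have := Fintype.ofFinite G
  have h : ∀ ψ : AddChar G ℂ, ((‖∑ a ∈ A, ψ a‖ ^ 2 : ℝ) : ℂ) = ∑ a ∈ A, ∑ b ∈ A, ψ (a - b) := by
    intro ψ
    push_cast
    rw [← Complex.mul_conj', map_sum, Finset.sum_mul_sum]
    refine Finset.sum_congr rfl fun a _ => Finset.sum_congr rfl fun b _ => ?_
    rw [← AddChar.map_neg_eq_conj, ← AddChar.map_add_eq_mul, sub_eq_add_neg]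
  have h2 : ((∑ ψ : AddChar G ℂ, ‖∑ a ∈ A, ψ a‖ ^ 2 : ℝ) : ℂ) = (A.card : ℂ) * Nat.card G := by
    push_cast
    have : ∀ ψ : AddChar G ℂ, ((‖∑ a ∈ A, ψ a‖ : ℂ)) ^ 2 = ∑ a ∈ A, ∑ b ∈ A, ψ (a - b) := by
      intro ψ; rw [← h]; push_cast; rfl
    simp_rw [this]
    rw [Finset.sum_comm]
    have h3 : ∀ a ∈ A, ∑ ψ : AddChar G ℂ, ∑ b ∈ A, ψ (a - b) = Nat.card G := by
      intro a ha
      rw [Finset.sum_comm]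
      simp_rw [AddChar.sum_apply_eq_ite, sub_eq_zero]
      simp [ha]
    rw [Finset.sum_congr rfl h3]
    simp
  exact_mod_cast h2

lemma addChar_map_sum {ι : Type*} (ψ : AddChar G ℂ) (s : Finset ι) (f : ι → G) :
    ψ (∑ i ∈ s, f i) = ∏ i ∈ s, ψ (f i) := by
  classical
  induction s using Finset.induction_on with
  | empty => simp
  | insert a s ha ih => rw [Finset.sum_insert ha, Finset.prod_insert ha, AddChar.map_add_eq_mul, ih]

lemma norm_charsum_le (ψ : AddChar G ℂ) {ι : Type*} (s : Finset ι) (f : ι → G) :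
    ‖∑ i ∈ s, ψ (f i)‖ ≤ s.card := by
  refine (norm_sum_le _ _).trans ?_
  simp [AddChar.norm_apply]

/-- A set all of whose nontrivial Fourier coefficients are small has full `r`-fold sumset. -/
lemma ms_full (A : Finset G) (hA : A.Nonempty) (s : ℕ)
    (h : ∀ ψ : AddChar G ℂ, ψ ≠ 0 → ‖∑ a ∈ A, ψ a‖ ≤ A.card / 4)
    (hs : Nat.card G < 4 ^ s * A.card) (u : G) : u ∈ ms (A : Set G) (s + 2) := by
  classical
  have hpos : (0 : ℝ) < A.card := by exact_mod_cast hA.card_pos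
  let S := Fintype.piFinset (fun _ : Fin (s + 2) => A)
  obtain ⟨p, hp, hv⟩ := exists_zero_of_sum S (fun p => ∑ i, p i - u) (by
    have e : ∀ ψ : AddChar G ℂ, ∑ p ∈ S, ψ (∑ i, p i - u) = (∑ a ∈ A, ψ a) ^ (s + 2) * ψ (-u) := by
      intro ψ
      rw [Finset.sum_pow', Finset.sum_mul]
      refine Finset.sum_congr rfl fun p _ => ?_
      rw [sub_eq_add_neg, AddChar.map_add_eq_mul, addChar_map_sum]
    simp_rw [e]
    rw [← Finset.add_sum_erase _ _ (Finset.mem_univ (0 : AddChar G ℂ))]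
    intro h0
    have h1 : ‖∑ ψ ∈ Finset.univ.erase (0 : AddChar G ℂ), (∑ a ∈ A, ψ a) ^ (s + 2) * ψ (-u)‖
        ≤ (A.card / 4 : ℝ) ^ s * (A.card * Nat.card G) := by
      refine (norm_sum_le _ _).trans ?_
      rw [← parseval, Finset.mul_sum]
      refine (Finset.sum_le_sum (g := fun ψ : AddChar G ℂ =>
        (A.card / 4 : ℝ) ^ s * ‖∑ a ∈ A, ψ a‖ ^ 2) ?_).trans ?_
      · intro ψ hψ
        rw [norm_mul, norm_pow, AddChar.norm_apply, mul_one, pow_add]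
        have := h ψ (Finset.ne_of_mem_erase hψ)
        gcongr
      · refine Finset.sum_le_sum_of_subset_of_nonneg (Finset.subset_univ _) fun _ _ _ => ?_
        positivity
    have h2 : ∑ ψ ∈ Finset.univ.erase (0 : AddChar G ℂ), (∑ a ∈ A, ψ a) ^ (s + 2) * ψ (-u)
        = - (A.card : ℂ) ^ (s + 2) := by
      rw [← neg_eq_iff_add_eq_zero.2 h0]
      simp
    rw [h2, norm_neg, norm_pow, Complex.norm_natCast] at h1
    have h3 : (Nat.card G : ℝ) < 4 ^ s * A.card := by exact_mod_cast hs
    have h4 : (A.card / 4 : ℝ) ^ s * (A.card * Nat.card G) < (A.card / 4 : ℝ) ^ s * (A.card * (4 ^ s * A.card)) := by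
      gcongr
    have h5 : (A.card / 4 : ℝ) ^ s * (A.card * (4 ^ s * A.card)) = (A.card : ℝ) ^ (s + 2) := by
      rw [div_pow]; field_simp; ring
    linarith)
  have := sum_mem_ms (Y := (A : Set G)) Finset.univ p
    (fun i _ => (Fintype.mem_piFinset.1 hp) i)
  rw [sub_eq_zero] at hv
  rw [hv] at this
  simpa using this

end fourier

lemma lemmaF (L : ℕ) : ∃ k0 : ℕ, ∀ (G : Type u) [AddCommGroup G] [Finite G] (S : Set G),
    (0 : G) ∈ S → (∀ j : ℕ, (ms S (j + 1)).ncard ≤ (2 * j + 2) ^ L * S.ncard) →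
    ms S k0 = Set.univ ∨ ∃ ξ : AddChar G ℂ, ξ ≠ 0 ∧ ∀ x ∈ S, ‖ξ x - 1‖ ≤ 1 / 2 := by
  obtain ⟨k1, hk1⟩ := poly_lt_exp 2 2 L 1 (17 / 16) (by norm_num) (by norm_num)
  obtain ⟨s0, hs0⟩ := poly_lt_exp (2 * (k1 + 1)) (4 * (k1 + 1)) L 4 4 (by norm_num) (by norm_num)
  refine ⟨(s0 + 2) * (k1 + 1), fun G _ _ S h0 hgr => ?_⟩
  classical
  by_cases hξ : ∃ ξ : AddChar G ℂ, ξ ≠ 0 ∧ ∀ x ∈ S, ‖ξ x - 1‖ ≤ 1 / 2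
  · exact Or.inr hξ
  left
  push Not at hξ
  have hSfin : S.Finite := Set.toFinite S
  have hSpos : 0 < S.ncard := (Set.ncard_pos hSfin).2 ⟨0, h0⟩
  obtain ⟨k, hk, hkd⟩ : ∃ k, k < k1 + 1 ∧
      ((ms S (k + 2)).ncard : ℝ) ≤ 17 / 16 * (ms S (k + 1)).ncard := by
    by_contra hcon
    push Not at hcon
    have : ∀ k, k ≤ k1 + 1 → (17 / 16 : ℝ) ^ k * S.ncard ≤ (ms S (k + 1)).ncard := by
      intro k
      induction k with
      | zero => intro _; simp [ms_one]
      | succ k ih =>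
        intro hk
        have h1 := hcon k (by omega)
        have h2 := ih (by omega)
        rw [pow_succ]
        nlinarith
    have h1 := this (k1 + 1) le_rfl
    have h2 := hgr (k1 + 1)
    have h3 := hk1 (k1 + 1) (by omega)
    have h4 : ((ms S (k1 + 1 + 1)).ncard : ℝ) ≤ ((2 * (k1 + 1) + 2 : ℕ) : ℝ) ^ L * S.ncard := by
      exact_mod_cast h2
    have h5 : (0 : ℝ) < S.ncard := by exact_mod_cast hSpos
    nlinarith
  let A : Finset G := (Set.toFinite (ms S (k + 1))).toFinset
  let B : Finset G := (Set.toFinite (ms S (k + 2))).toFinset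
  have hAc : A.card = (ms S (k + 1)).ncard := (Set.ncard_eq_toFinset_card _ _).symm
  have hBc : B.card = (ms S (k + 2)).ncard := (Set.ncard_eq_toFinset_card _ _).symm
  have hAS : (A : Set G) = ms S (k + 1) := by simp [A]
  have hAne : A.Nonempty := ⟨0, by simpa [A] using zero_mem_ms h0 (k + 1)⟩
  have hApos : (0 : ℝ) < A.card := by exact_mod_cast hAne.card_pos
  have hsmall : ∀ ψ : AddChar G ℂ, ψ ≠ 0 → ‖∑ a ∈ A, ψ a‖ ≤ A.card / 4 := by
    intro ψ hψ
    obtain ⟨x, hx, hx2⟩ := hξ ψ hψ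
    let A' := A.image (x + ·)
    have hAB : A ⊆ B := by
      intro a ha
      simp only [A, B, Set.Finite.mem_toFinset] at ha ⊢
      exact ms_succ_mono h0 _ ha
    have hA'B : A' ⊆ B := by
      intro a ha
      simp only [A', A, B, Finset.mem_image, Set.Finite.mem_toFinset] at ha ⊢
      obtain ⟨b, hb, rfl⟩ := ha
      exact ⟨b, hb, x, hx, add_comm _ _⟩
    have hA'c : A'.card = A.card := Finset.card_image_of_injective _ (add_right_injective x)
    have hsum : ∑ a ∈ A', ψ a = ψ x * ∑ a ∈ A, ψ a := by
      rw [Finset.sum_image (fun a _ b _ h => add_right_injective x h), Finset.mul_sum]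
      simp only [AddChar.map_add_eq_mul]
    have hd : ∀ C ⊆ B, C.card = A.card → ‖∑ a ∈ B, ψ a - ∑ a ∈ C, ψ a‖ ≤ A.card / 16 := by
      intro C hC hCc
      rw [← Finset.sum_sdiff hC, add_sub_cancel_right]
      refine (norm_charsum_le ψ _ id).trans ?_
      rw [Finset.card_sdiff_of_subset hC, Nat.cast_sub (Finset.card_le_card hC), hCc, hBc, hAc]
      linarith
    have h1 := hd A hAB rfl
    have h2 := hd A' hA'B hA'c
    rw [hsum] at h2
    have h3 : ‖(ψ x - 1) * ∑ a ∈ A, ψ a‖ ≤ A.card / 8 := by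
      have : (ψ x - 1) * ∑ a ∈ A, ψ a = (∑ a ∈ B, ψ a - ∑ a ∈ A, ψ a)
        - (∑ a ∈ B, ψ a - ψ x * ∑ a ∈ A, ψ a) := by ring
      rw [this]
      refine (norm_sub_le _ _).trans ?_
      linarith
    rw [norm_mul] at h3
    nlinarith [norm_nonneg (∑ a ∈ A, ψ a)]
  have hex : ∃ s, Nat.card G < 4 ^ s * A.card := by
    obtain ⟨s, hs⟩ := pow_unbounded_of_one_lt (Nat.card G) (by norm_num : 1 < 4)
    exact ⟨s, hs.trans_le (Nat.le_mul_of_pos_right _ hAne.card_pos)⟩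
  have hfull := ms_full A hAne (Nat.find hex) hsmall (Nat.find_spec hex)
  set s := Nat.find hex with hs
  rw [hAS, ms_mul] at hfull
  have hAG : A.card ≤ Nat.card G := by
    rw [← Set.ncard_coe_finset, ← Set.ncard_univ]
    exact Set.ncard_le_ncard (Set.subset_univ _) Set.finite_univ
  have hs1 : 1 ≤ s := by
    by_contra h
    have h0 : s = 0 := by omega
    have := Nat.find_spec hex
    rw [← hs, h0] at this
    omega
  have hs2 : 4 ^ (s - 1) * A.card ≤ Nat.card G := by
    by_contra h
    push Not at h
    have := Nat.find_min' hex h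
    omega
  have hss : s < s0 := by
    by_contra h
    push Not at h
    have h1 := hs0 s h
    have huniv : ms S ((k + 1) * (s + 2)) = Set.univ := Set.eq_univ_of_forall hfull
    obtain ⟨j, hj⟩ : ∃ j, (k + 1) * (s + 2) = j + 1 := ⟨(k + 1) * (s + 2) - 1, by
      have : 0 < (k + 1) * (s + 2) := by positivity
      omega⟩
    have h2 := hgr j
    rw [← hj, huniv, Set.ncard_univ] at h2
    have h3 : S.ncard ≤ A.card := by
      rw [hAc]
      refine Set.ncard_le_ncard ?_ (Set.toFinite _)
      have := ms_mono (Y := S) h0 (show 1 ≤ k + 1 by omega)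
      rwa [ms_one] at this
    have h4 : 2 * j + 2 ≤ 2 * (k1 + 1) * s + 4 * (k1 + 1) := by
      have : 2 * j + 2 = 2 * ((k + 1) * (s + 2)) := by omega
      rw [this]
      have : (k + 1) * (s + 2) ≤ (k1 + 1) * (s + 2) := Nat.mul_le_mul_right _ (by omega)
      nlinarith
    have h5 : 4 ^ (s - 1) * A.card ≤ (2 * (k1 + 1) * s + 4 * (k1 + 1)) ^ L * A.card :=
      hs2.trans (h2.trans (Nat.mul_le_mul (Nat.pow_le_pow_left h4 L) h3))
    have h6 := Nat.le_of_mul_le_mul_right h5 hAne.card_pos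
    have h7 : 4 ^ s ≤ 4 * (2 * (k1 + 1) * s + 4 * (k1 + 1)) ^ L := by
      obtain ⟨s', hs'⟩ : ∃ s', s = s' + 1 := ⟨s - 1, by omega⟩
      rw [hs'] at h6 ⊢
      rw [pow_succ]
      simp only [Nat.add_sub_cancel] at h6
      omega
    have h8 : ((4 : ℝ) ^ s) ≤ 4 * ((2 * (k1 + 1) * s + 4 * (k1 + 1) : ℕ) : ℝ) ^ L := by
      exact_mod_cast h7
    linarith
  refine Set.eq_univ_of_forall fun u => ms_mono h0 ?_ (hfull u)
  rw [mul_comm]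
  exact Nat.mul_le_mul (by omega) (by omega)

lemma norm_pow_sub_one_le (z : ℂ) (hz : ‖z‖ = 1) (j : ℕ) : ‖z ^ j - 1‖ ≤ j * ‖z - 1‖ := by
  induction j with
  | zero => simp
  | succ j ih =>
    have : z ^ (j + 1) - 1 = z ^ j * (z - 1) + (z ^ j - 1) := by ring
    rw [this]
    refine (norm_add_le _ _).trans ?_
    rw [norm_mul, norm_pow, hz, one_pow]
    push_cast
    linarith

lemma orbit (L : ℕ) : ∃ k0 : ℕ, ∀ (G : Type u) [AddCommGroup G] (Y : Set G), Y.Finite →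
    (0 : G) ∈ Y → (∀ y ∈ Y, -y ∈ Y) → Cov (Y + Y) Y L →
    ∀ (c : G) (N : ℕ), (∀ i ≤ N, 2 ^ i • c ∈ Y) → 1 ≤ N →
      ((N ^ L * Y.ncard : ℕ) : ℝ) < (3 / 2) ^ N →
      ((AddSubgroup.zmultiples c : AddSubgroup G) : Set G) ⊆ ms Y k0 := by
  obtain ⟨k0, hk0⟩ := lemmaF.{u} L
  refine ⟨2 * k0, fun G _ Y hY h0 hs hc c N hcY hN hlt => ?_⟩
  classical
  obtain ⟨Q, hQ⟩ : ∃ Q, Q = N ^ L * Y.ncard := ⟨_, rfl⟩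
  rw [← hQ] at hlt
  have hQ2 : Q < 2 ^ N := by
    have : ((3 / 2 : ℝ)) ^ N ≤ 2 ^ N := by gcongr; norm_num
    have : (Q : ℝ) < 2 ^ N := by linarith
    exact_mod_cast this
  have hbin : ∀ n, n ≤ N → ∀ j, j < 2 ^ n → j • c ∈ ms Y n := by
    intro n
    induction n with
    | zero => intro _ j hj; have : j = 0 := by simpa using hj
              subst this; simp [ms]
    | succ n ih =>
      intro hn j hj
      by_cases h : j < 2 ^ n
      · exact ms_succ_mono h0 n (ih (by omega) j h)
      · refine ⟨(j - 2 ^ n) • c, ih (by omega) _ (by rw [pow_succ] at hj; omega), 2 ^ n • c,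
          hcY n (by omega), ?_⟩
        simp only []
        rw [← add_nsmul]; congr 1; omega
  have hcardN : (ms Y N).ncard ≤ Q := by
    obtain ⟨N', rfl⟩ : ∃ N', N = N' + 1 := ⟨N - 1, by omega⟩
    rw [hQ]
    exact ((ms_cov_poly hc N').card hY).2
  -- finite order
  obtain ⟨q, hq0, hqQ, hqc⟩ : ∃ q, 0 < q ∧ q ≤ Q ∧ q • c = 0 := by
    have hmaps : ∀ j ∈ Finset.range (Q + 1), j • c ∈ (ms_finite hY N).toFinset := by
      intro j hj
      simp only [Set.Finite.mem_toFinset]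
      exact hbin N le_rfl j (by have := Finset.mem_range.1 hj; omega)
    have hcard : (ms_finite hY N).toFinset.card < (Finset.range (Q + 1)).card := by
      rw [← Set.ncard_eq_toFinset_card _ (ms_finite hY N), Finset.card_range]; omega
    obtain ⟨i, hi, j, hj, hne, he⟩ := Finset.exists_ne_map_eq_of_card_lt_of_maps_to hcard hmaps
    simp only [Finset.mem_range] at hi hj
    have key : ∀ i j : ℕ, i < j → j ≤ Q → i • c = j • c → ∃ q, 0 < q ∧ q ≤ Q ∧ q • c = 0 := by
      intro i j hij hjQ he
      refine ⟨j - i, by omega, by omega, ?_⟩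
      have : j • c = (j - i) • c + i • c := by rw [← add_nsmul]; congr 1; omega
      rw [this] at he
      simpa using he
    rcases lt_or_gt_of_ne hne with h | h
    · exact key i j h (by omega) he
    · exact key j i h (by omega) he.symm
  have hrep : ∀ g ∈ AddSubgroup.zmultiples c, ∃ j : ℕ, j < q ∧ g = j • c := by
    intro g hg
    obtain ⟨m, rfl⟩ := AddSubgroup.mem_zmultiples_iff.1 hg
    refine ⟨(m % q).toNat, ?_, ?_⟩
    · have := Int.emod_lt_of_pos m (by exact_mod_cast hq0 : (0 : ℤ) < q)
      have := Int.emod_nonneg m (by positivity : (q : ℤ) ≠ 0)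
      omega
    · have h1 : ((m % q).toNat : ℤ) = m % q :=
        Int.toNat_of_nonneg (Int.emod_nonneg m (by positivity : (q : ℤ) ≠ 0))
      rw [← natCast_zsmul, h1]
      conv_lhs => rw [← Int.emod_add_mul_ediv m q]
      rw [add_zsmul, mul_comm, mul_zsmul, natCast_zsmul, hqc, zsmul_zero, add_zero]
  have hfin : Finite (AddSubgroup.zmultiples c) := by
    have : ((AddSubgroup.zmultiples c : AddSubgroup G) : Set G) ⊆
        ((Finset.range q).image (fun j : ℕ => j • c) : Finset G) := by
      intro g hg
      obtain ⟨j, hj, rfl⟩ := hrep g hg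
      simp only [Finset.coe_image, Set.mem_image, Finset.mem_coe, Finset.mem_range]
      exact ⟨j, hj, rfl⟩
    exact (Finset.finite_toSet _).subset this
  let H := AddSubgroup.zmultiples c
  let S : Set H := {g | (g : G) ∈ Y + Y}
  have hmsS : ∀ j, ∀ g ∈ ms S j, (g : G) ∈ ms Y (2 * j) := by
    intro j
    induction j with
    | zero => intro g hg; simp only [ms, Set.mem_singleton_iff] at hg; subst hg; simp [ms]
    | succ j ih =>
      rintro _ ⟨a, ha, b, hb, rfl⟩
      rw [Nat.mul_succ, ms_add, ms_two]
      exact ⟨a, ih a ha, b, hb, rfl⟩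
  have hS0 : (0 : H) ∈ S := ⟨0, h0, 0, h0, by simp⟩
  rcases hk0 H S hS0 (by
    intro j
    have h1 : Cov ((fun g : H => (g : G)) '' ms S (j + 1)) Y ((2 * j + 2) ^ L) := by
      refine (ms_cov_poly hc (2 * j + 1)).mono ?_ subset_rfl le_rfl
      rintro _ ⟨g, hg, rfl⟩
      exact hmsS (j + 1) g hg
    obtain ⟨F, hF, hFA, hcov⟩ := h1.inside
    refine (Cov.card (B := S) (N := (2 * j + 2) ^ L) ?_ (Set.toFinite S)).2
    have hFH : ∀ f ∈ F, f ∈ H := fun f hf => by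
      obtain ⟨g, _, rfl⟩ := hFA hf; exact g.2
    refine ⟨F.attach.image (fun f => ⟨f.1, hFH f.1 f.2⟩), Finset.card_image_le.trans
      (by simpa using hF), ?_⟩
    intro a ha
    obtain ⟨f, hf, y, hy, y', hy', he⟩ := hcov a ⟨a, ha, rfl⟩
    refine ⟨⟨f, hFH f hf⟩, by simp [hf], ?_⟩
    refine ⟨y, hy, -y', hs y' hy', ?_⟩
    simp only [] at he ⊢
    rw [← sub_eq_add_neg, he]; rfl) with h | ⟨ξ, hξ, hξS⟩
  · intro g hg
    have : (⟨g, hg⟩ : H) ∈ ms S k0 := by rw [h]; trivial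
    exact hmsS k0 _ this
  · exfalso
    let c' : H := ⟨c, AddSubgroup.mem_zmultiples c⟩
    set z := ξ c' with hz
    have hz1 : ‖z‖ = 1 := AddChar.norm_apply ξ c'
    have hzi : ∀ i, i ≤ N → ‖z ^ (2 ^ i) - 1‖ ≤ 1 / 2 := by
      intro i hi
      rw [hz, ← AddChar.map_nsmul_eq_pow]
      apply hξS
      refine ⟨2 ^ i • c, hcY i hi, 0, h0, ?_⟩
      simp [c']
    have hgrow : ∀ i, i ≤ N → (3 / 2 : ℝ) ^ i * ‖z - 1‖ ≤ ‖z ^ (2 ^ i) - 1‖ := by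
      intro i
      induction i with
      | zero => simp
      | succ i ih =>
        intro hi
        have h1 := ih (by omega)
        have h2 := hzi i (by omega)
        set w := z ^ (2 ^ i) with hw
        have h3 : z ^ (2 ^ (i + 1)) - 1 = (w - 1) * (w + 1) := by
          rw [hw, pow_succ 2, pow_mul]; ring
        have h4 : 3 / 2 ≤ ‖w + 1‖ := by
          have h5 : (2 : ℂ) = (w + 1) - (w - 1) := by ring
          have h6 := norm_sub_le (w + 1) (w - 1)
          rw [← h5] at h6
          simp at h6
          linarith
        rw [h3, norm_mul, pow_succ]
        nlinarith [norm_nonneg (w - 1)]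
    have h1 := hgrow N le_rfl
    have h2 := hzi N le_rfl
    have hsm : (Q : ℝ) * ‖z - 1‖ ≤ 1 / 2 := by
      nlinarith [norm_nonneg (z - 1)]
    have hre : ∀ g : H, 0 < (ξ g).re := by
      intro g
      obtain ⟨j, hj, hg⟩ := hrep g.1 g.2
      have : g = j • c' := Subtype.ext (by simpa [c'] using hg)
      rw [this, AddChar.map_nsmul_eq_pow]
      have h3 := norm_pow_sub_one_le z hz1 j
      have h4 : (j : ℝ) ≤ Q := by exact_mod_cast (by omega : j ≤ Q)
      have h5 : ‖z ^ j - 1‖ ≤ 1 / 2 := by nlinarith [norm_nonneg (z - 1)]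
      have h6 := (Complex.abs_re_le_norm (z ^ j - 1)).trans h5
      rw [abs_le] at h6
      simp only [Complex.sub_re, Complex.one_re] at h6
      linarith [h6.1]
    have := Fintype.ofFinite H
    have h3 := AddChar.sum_eq_zero_iff_ne_zero.2 hξ
    have h4 : (∑ x : H, ξ x).re = 0 := by rw [h3]; rfl
    rw [Complex.re_sum] at h4
    have h5 : 0 < ∑ x : H, (ξ x).re := Finset.sum_pos (fun g _ => hre g) ⟨0, Finset.mem_univ _⟩
    linarith

end part4

section part5

lemma refine_pop_aux (g : ℕ → ℕ) (q : ℕ) : ∀ M1 : ℕ, ∃ M0 : ℕ,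
    ∀ (α β ι : Type u) (I : Finset ι) (f : ι → α → β) (X : Finset α) (n : ℕ), I.card ≤ q →
      X.Nonempty → n ≤ M1 * X.card → ∃ X2 ⊆ X, X2.Nonempty ∧ ∃ M ≤ M0, n ≤ M * X2.card ∧
        ∀ i ∈ I, (∀ x ∈ X2, ∀ y ∈ X2, f i x = f i y) ∨
          ∀ y ∈ X2, ∀ S ⊆ X2, (∀ x ∈ S, f i x = f i y) → g M * S.card ≤ X2.card := by
  induction q with
  | zero =>
    intro M1
    refine ⟨M1, fun α β ι I f X n hI hX hn => ⟨X, subset_rfl, hX, M1, le_rfl, hn, ?_⟩⟩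
    intro i hi
    rw [Finset.card_eq_zero.1 (Nat.le_zero.1 hI)] at hi
    simp at hi
  | succ q ih =>
    intro M1
    obtain ⟨M0, h⟩ := ih (M1 * g M1)
    refine ⟨max M1 M0, fun α β ι I f X n hI hX hn => ?_⟩
    classical
    by_cases hall : ∀ i ∈ I, ∀ y ∈ X, ∀ S ⊆ X, (∀ x ∈ S, f i x = f i y) → g M1 * S.card ≤ X.card
    · exact ⟨X, subset_rfl, hX, M1, le_max_left _ _, hn, fun i hi => Or.inr (hall i hi)⟩
    · push Not at hall
      obtain ⟨i, hi, y, hy, S, hS, hSf, hlt⟩ := hall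
      have hSne : S.Nonempty := by
        rw [Finset.nonempty_iff_ne_empty]
        rintro rfl
        simp at hlt
      obtain ⟨X2, hX2, hne, M, hM, hnM, hI2⟩ := h α β ι (I.erase i) f S n
        (by rw [Finset.card_erase_of_mem hi]; omega) hSne
        (hn.trans (by rw [mul_assoc]; exact Nat.mul_le_mul_left _ hlt.le))
      refine ⟨X2, hX2.trans hS, hne, M, hM.trans (le_max_right _ _), hnM, ?_⟩
      intro j hj
      by_cases hji : j = i
      · subst hji
        exact Or.inl fun x hx z hz => (hSf x (hX2 hx)).trans (hSf z (hX2 hz)).symm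
      · exact hI2 j (Finset.mem_erase.2 ⟨hji, hj⟩)

lemma refine_pop (g : ℕ → ℕ) (q : ℕ) : ∃ M0 : ℕ,
    ∀ (α β ι : Type u) (I : Finset ι) (f : ι → α → β) (X : Finset α), I.card ≤ q →
      X.Nonempty → ∃ X2 ⊆ X, X2.Nonempty ∧ ∃ M ≤ M0, X.card ≤ M * X2.card ∧
        ∀ i ∈ I, (∀ x ∈ X2, ∀ y ∈ X2, f i x = f i y) ∨
          ∀ y ∈ X2, ∀ S ⊆ X2, (∀ x ∈ S, f i x = f i y) → g M * S.card ≤ X2.card := by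
  obtain ⟨M0, h⟩ := refine_pop_aux.{u} g q 1
  exact ⟨M0, fun α β ι I f X hI hX => h α β ι I f X X.card hI hX (by simp)⟩

section four
variable {G : Type u} [AddCommGroup G] [Finite G]

lemma largecount (A : Finset G) (hA : A.Nonempty) (B : ℕ) (S : Finset (AddChar G ℂ))
    (hS : ∀ ψ ∈ S, (A.card : ℝ) ≤ B * ‖∑ a ∈ A, ψ a‖) : S.card * A.card ≤ B ^ 2 * Nat.card G := by
  have hpos : (0 : ℝ) < A.card := by exact_mod_cast hA.card_pos
  have h1 : (S.card : ℝ) * (A.card : ℝ) ^ 2 ≤ B ^ 2 * (A.card * Nat.card G) := by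
    rw [← parseval, Finset.mul_sum, ← nsmul_eq_mul]
    refine (Finset.card_nsmul_le_sum S (fun ψ => (B : ℝ) ^ 2 * ‖∑ a ∈ A, ψ a‖ ^ 2) _ ?_).trans
      (Finset.sum_le_sum_of_subset_of_nonneg (Finset.subset_univ _) fun _ _ _ => by positivity)
    intro ψ hψ
    rw [← mul_pow]
    exact pow_le_pow_left₀ hpos.le (hS ψ hψ) 2
  have h2 : (S.card : ℝ) * A.card ≤ B ^ 2 * Nat.card G := by
    nlinarith
  exact_mod_cast h2

lemma badcount {α : Type u} (X2 : Finset α) (f : α → AddChar G ℂ) (g : ℕ)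
    (hf : ∀ y ∈ X2, ∀ S ⊆ X2, (∀ x ∈ S, f x = f y) → g * S.card ≤ X2.card)
    (A : Finset G) (hA : A.Nonempty) (B : ℕ) (bad : Finset α) (hb : bad ⊆ X2)
    (hbad : ∀ x ∈ bad, (A.card : ℝ) ≤ B * ‖∑ a ∈ A, f x a‖) :
    bad.card * g * A.card ≤ B ^ 2 * Nat.card G * X2.card := by
  classical
  have h1 : bad.card * g ≤ (bad.image f).card * X2.card := by
    rw [Finset.card_eq_sum_card_image f bad, Finset.sum_mul]
    refine (Finset.sum_le_card_nsmul _ _ X2.card ?_).trans (by simp)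
    intro ψ hψ
    obtain ⟨y, hy, rfl⟩ := Finset.mem_image.1 hψ
    rw [mul_comm]
    refine hf y (hb hy) _ ((Finset.filter_subset _ _).trans hb) ?_
    intro x hx
    exact (Finset.mem_filter.1 hx).2
  have h2 := largecount A hA B (bad.image f) (by
    intro ψ hψ
    obtain ⟨y, hy, rfl⟩ := Finset.mem_image.1 hψ
    exact hbad y hy)
  calc bad.card * g * A.card ≤ (bad.image f).card * X2.card * A.card := Nat.mul_le_mul_right _ h1
    _ = ((bad.image f).card * A.card) * X2.card := by ring
    _ ≤ _ := Nat.mul_le_mul_right _ h2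

lemma analytic {ι : Type u} (D : Finset G) (hD : D.Nonempty) (A : ℕ)
    (hA : Nat.card G ≤ A * D.card) (E : Finset ι) (hE : E.Nonempty) (w : ι → G → G) (u : G)
    (hΓ : ∀ χ : AddChar G ℂ, (D.card : ℝ) ≤ (2 * A : ℕ) * ‖∑ d ∈ D, χ d‖ →
      (χ u = 1 ∧ ∀ x ∈ E, ∀ t ∈ D, χ (w x t) = 1) ∨
      (16 * A ^ 3 : ℝ) * ‖∑ x ∈ E, ∑ t ∈ D, χ (w x t)‖ ≤ E.card * D.card) :
    ∃ d1 ∈ D, ∃ d2 ∈ D, ∃ d3 ∈ D, ∃ d4 ∈ D, ∃ x ∈ E, ∃ t ∈ D, u = d1 + d2 - d3 - d4 + w x t := by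
  classical
  have hd : (0 : ℝ) < D.card := by exact_mod_cast hD.card_pos
  have he : (0 : ℝ) < E.card := by exact_mod_cast hE.card_pos
  have hG : 0 < Nat.card G := Nat.card_pos
  have hA1 : 1 ≤ A := by
    by_contra h
    have : A = 0 := by omega
    subst this; omega
  have hA1' : (1 : ℝ) ≤ A := by exact_mod_cast hA1
  have hA' : (Nat.card G : ℝ) ≤ A * D.card := by exact_mod_cast hA
  set Φ : AddChar G ℂ → ℂ := fun χ => ∑ x ∈ E, ∑ t ∈ D, χ (w x t) with hΦ
  set W : AddChar G ℂ → ℝ := fun χ => ‖∑ d ∈ D, χ d‖ with hW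
  let s := (D ×ˢ D) ×ˢ (D ×ˢ D) ×ˢ (E ×ˢ D)
  let v : (G × G) × (G × G) × (ι × G) → G := fun p =>
    p.1.1 + p.1.2 + (-p.2.1.1) + (-p.2.1.2) + w p.2.2.1 p.2.2.2 + (-u)
  have hsum : ∀ χ : AddChar G ℂ, ∑ p ∈ s, χ (v p) = ((W χ ^ 4 : ℝ) : ℂ) * (Φ χ * χ (-u)) := by
    intro χ
    have h1 : ∑ d ∈ D, χ (-d) = (starRingEnd ℂ) (∑ d ∈ D, χ d) := by
      rw [map_sum]; simp only [AddChar.map_neg_eq_conj]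
    have h2 : ((W χ ^ 4 : ℝ) : ℂ) = (∑ d ∈ D, χ d) * (∑ d ∈ D, χ d) *
        ((∑ d ∈ D, χ (-d)) * (∑ d ∈ D, χ (-d))) := by
      have h3 : (∑ d ∈ D, χ d) * (∑ d ∈ D, χ (-d)) = ((W χ : ℝ) : ℂ) ^ 2 := by
        rw [h1, Complex.mul_conj']
      have h4 : (∑ d ∈ D, χ d) * (∑ d ∈ D, χ d) *
        ((∑ d ∈ D, χ (-d)) * (∑ d ∈ D, χ (-d))) = ((∑ d ∈ D, χ d) * (∑ d ∈ D, χ (-d))) ^ 2 := by ring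
      rw [h4, h3]; push_cast; ring
    rw [h2]
    simp only [s, v, AddChar.map_add_eq_mul, Finset.sum_product, hΦ]
    simp only [← Finset.mul_sum, ← Finset.sum_mul]
    ring
  obtain ⟨p, hp, hv⟩ := exists_zero_of_sum s v (by
    simp_rw [hsum]
    set Γ : Finset (AddChar G ℂ) :=
      Finset.univ.filter (fun χ => (D.card : ℝ) ≤ (2 * A : ℕ) * ‖∑ d ∈ D, χ d‖) with hΓd
    have hΓc : (Γ.card : ℝ) ≤ 4 * A ^ 3 := by
      have h1 := largecount D hD (2 * A) Γ (fun ψ hψ => (Finset.mem_filter.1 hψ).2)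
      have h2 : Γ.card * D.card ≤ (4 * A ^ 3) * D.card := by
        calc _ ≤ _ := h1
          _ ≤ (2 * A) ^ 2 * (A * D.card) := Nat.mul_le_mul_left _ hA
          _ = _ := by ring
      exact_mod_cast Nat.le_of_mul_le_mul_right h2 hD.card_pos
    have hWd : ∀ χ, W χ ≤ D.card := fun χ => norm_charsum_le χ D id
    have hΦd : ∀ χ, ‖Φ χ‖ ≤ E.card * D.card := by
      intro χ
      refine (norm_sum_le _ _).trans ?_
      rw [← nsmul_eq_mul]
      exact Finset.sum_le_card_nsmul _ _ _ fun x _ => norm_charsum_le χ D (w x)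
    have hlow : ∀ χ : AddChar G ℂ, -((if χ ∈ Γ then (D.card : ℝ) ^ 4 * (E.card * D.card / (16 * A ^ 3)) else 0)
        + W χ ^ 2 * ((D.card : ℝ) ^ 2 / (4 * A ^ 2) * (E.card * D.card)))
        ≤ (((W χ ^ 4 : ℝ) : ℂ) * (Φ χ * χ (-u))).re := by
      intro χ
      have hW0 : 0 ≤ W χ := norm_nonneg _
      have hnorm : -(W χ ^ 4 * ‖Φ χ‖) ≤ (((W χ ^ 4 : ℝ) : ℂ) * (Φ χ * χ (-u))).re := by
        have h1 := Complex.abs_re_le_norm (((W χ ^ 4 : ℝ) : ℂ) * (Φ χ * χ (-u)))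
        rw [norm_mul, norm_mul, AddChar.norm_apply, mul_one, Complex.norm_real,
          Real.norm_of_nonneg (by positivity)] at h1
        exact (abs_le.1 h1).1
      by_cases hχ : χ ∈ Γ
      · rw [if_pos hχ]
        rcases hΓ χ (Finset.mem_filter.1 hχ).2 with ⟨h1, h2⟩ | h1
        · have h3 : Φ χ = ((E.card * D.card : ℝ) : ℂ) := by
            rw [hΦ]
            have : ∀ x ∈ E, ∑ t ∈ D, χ (w x t) = (D.card : ℂ) := fun x hx => by
              rw [Finset.sum_congr rfl (h2 x hx)]; simp
            simp only []
            rw [Finset.sum_congr rfl this]; simp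
          rw [h3, AddChar.map_neg_eq_conj, h1, map_one, mul_one, ← Complex.ofReal_mul,
            Complex.ofReal_re]
          have : 0 ≤ W χ ^ 4 * ((E.card : ℝ) * D.card) := by positivity
          refine le_trans ?_ this
          rw [neg_nonpos]
          positivity
        · refine le_trans ?_ hnorm
          rw [neg_le_neg_iff]
          have h4 : ‖Φ χ‖ ≤ E.card * D.card / (16 * A ^ 3) := by
            rw [le_div_iff₀ (by positivity), mul_comm]; exact h1
          have h5 : W χ ^ 4 * ‖Φ χ‖ ≤ (D.card : ℝ) ^ 4 * (E.card * D.card / (16 * A ^ 3)) := by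
            have := hWd χ
            gcongr
          have h6 : 0 ≤ W χ ^ 2 * ((D.card : ℝ) ^ 2 / (4 * A ^ 2) * (E.card * D.card)) := by positivity
          linarith
      · rw [if_neg hχ, zero_add]
        refine le_trans ?_ hnorm
        rw [neg_le_neg_iff]
        have h1 : (2 * A : ℝ) * W χ ≤ D.card := by
          by_contra hcon
          apply hχ
          rw [hΓd, Finset.mem_filter]
          refine ⟨Finset.mem_univ _, ?_⟩
          push_cast
          exact (not_le.1 hcon).le
        have h2 : W χ ^ 2 ≤ (D.card : ℝ) ^ 2 / (4 * A ^ 2) := by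
          rw [le_div_iff₀ (by positivity)]
          have := pow_le_pow_left₀ (by positivity) h1 2
          nlinarith
        have h3 : W χ ^ 4 * ‖Φ χ‖ = W χ ^ 2 * (W χ ^ 2 * ‖Φ χ‖) := by ring
        rw [h3]
        have := hΦd χ
        gcongr
    have h0 : (((W 0 ^ 4 : ℝ) : ℂ) * (Φ 0 * (0 : AddChar G ℂ) (-u))).re = (D.card : ℝ) ^ 4 * (E.card * D.card) := by
      have h1 : W 0 = D.card := by simp [hW]
      have h2 : Φ 0 = ((E.card * D.card : ℝ) : ℂ) := by simp [hΦ]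
      rw [h1, h2, AddChar.zero_apply, mul_one, ← Complex.ofReal_mul, Complex.ofReal_re]
    intro hzero
    have hre := congrArg Complex.re hzero
    rw [Complex.re_sum, ← Finset.add_sum_erase _ _ (Finset.mem_univ (0 : AddChar G ℂ)), h0,
      Complex.zero_re] at hre
    have h3 : -(∑ χ : AddChar G ℂ, ((if χ ∈ Γ then (D.card : ℝ) ^ 4 * (E.card * D.card / (16 * A ^ 3)) else 0)
        + W χ ^ 2 * ((D.card : ℝ) ^ 2 / (4 * A ^ 2) * (E.card * D.card)))) ≤
        ∑ χ ∈ Finset.univ.erase (0 : AddChar G ℂ), (((W χ ^ 4 : ℝ) : ℂ) * (Φ χ * χ (-u))).re := by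
      refine le_trans ?_ (Finset.sum_le_sum fun χ _ => hlow χ)
      rw [Finset.sum_neg_distrib, neg_le_neg_iff]
      refine Finset.sum_le_sum_of_subset_of_nonneg (Finset.erase_subset _ _) fun χ _ _ => ?_
      have : 0 ≤ (if χ ∈ Γ then (D.card : ℝ) ^ 4 * (E.card * D.card / (16 * A ^ 3)) else 0) := by
        split_ifs
        · positivity
        · exact le_rfl
      have h6 : 0 ≤ W χ ^ 2 * ((D.card : ℝ) ^ 2 / (4 * A ^ 2) * (E.card * D.card)) := by positivity
      linarith
    rw [Finset.sum_add_distrib, ← Finset.sum_mul] at h3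
    have h4 : ∑ χ : AddChar G ℂ, (if χ ∈ Γ then (D.card : ℝ) ^ 4 * (E.card * D.card / (16 * A ^ 3)) else 0)
        ≤ (D.card : ℝ) ^ 4 * (E.card * D.card) / 4 := by
      rw [← Finset.sum_filter, Finset.sum_const, nsmul_eq_mul, Finset.filter_mem_eq_inter,
        Finset.univ_inter]
      calc (Γ.card : ℝ) * ((D.card : ℝ) ^ 4 * (E.card * D.card / (16 * A ^ 3)))
          ≤ (4 * A ^ 3) * ((D.card : ℝ) ^ 4 * (E.card * D.card / (16 * A ^ 3))) := by gcongr
        _ = _ := by field_simp; norm_num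
    have h5 : (∑ χ : AddChar G ℂ, W χ ^ 2) * ((D.card : ℝ) ^ 2 / (4 * A ^ 2) * (E.card * D.card)) ≤
        (D.card : ℝ) ^ 4 * (E.card * D.card) / 4 := by
      have hp := parseval D
      simp only [hW]
      rw [hp]
      calc (D.card : ℝ) * Nat.card G * ((D.card : ℝ) ^ 2 / (4 * A ^ 2) * (E.card * D.card))
          ≤ (D.card : ℝ) * (A * D.card) * ((D.card : ℝ) ^ 2 / (4 * A ^ 2) * (E.card * D.card)) := by
            gcongr
        _ = ((D.card : ℝ) ^ 4 * (E.card * D.card) / 4) / A := by field_simp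
        _ ≤ _ := div_le_self (by positivity) hA1'
    have h6 : 0 < (D.card : ℝ) ^ 4 * (E.card * D.card) := by positivity
    linarith)
  simp only [s, Finset.mem_product] at hp
  obtain ⟨⟨h1, h2⟩, ⟨h3, h4⟩, h5, h6⟩ := hp
  refine ⟨_, h1, _, h2, _, h3, _, h4, _, h5, _, h6, ?_⟩
  have := add_neg_eq_zero.1 hv
  rw [← this]
  abel
end four

end part5

section part6

lemma badunion {G : Type u} [AddCommGroup G] [Finite G] {α : Type u} (X2 : Finset α)
    (Γ : Finset (AddChar G ℂ)) (P : AddChar G ℂ → Prop) (f : AddChar G ℂ → α → AddChar G ℂ) (g : ℕ)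
    (hf : ∀ χ ∈ Γ, ¬ P χ → ∀ y ∈ X2, ∀ S ⊆ X2, (∀ x ∈ S, f χ x = f χ y) → g * S.card ≤ X2.card)
    (A : Finset G) (hA : A.Nonempty) (B : ℕ) :
    ∃ bad ⊆ X2, bad.card * g * A.card ≤ Γ.card * (B ^ 2 * Nat.card G * X2.card) ∧
      ∀ x ∈ X2, x ∉ bad → ∀ χ ∈ Γ, ¬ P χ → B * ‖∑ a ∈ A, f χ x a‖ < A.card := by
  classical
  let bd : AddChar G ℂ → Finset α := fun χ =>
    X2.filter (fun x => ¬ P χ ∧ (A.card : ℝ) ≤ B * ‖∑ a ∈ A, f χ x a‖)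
  refine ⟨Γ.biUnion bd, ?_, ?_, ?_⟩
  · intro x hx
    obtain ⟨χ, _, hx⟩ := Finset.mem_biUnion.1 hx
    exact (Finset.mem_filter.1 hx).1
  · have h1 : ∀ χ ∈ Γ, (bd χ).card * g * A.card ≤ B ^ 2 * Nat.card G * X2.card := by
      intro χ hχ
      by_cases hP : P χ
      · have : bd χ = ∅ := by
          simp only [bd, Finset.filter_eq_empty_iff]
          intro x _ h
          exact h.1 hP
        rw [this]; simp
      · refine badcount X2 (f χ) g (hf χ hχ hP) A hA B (bd χ) (Finset.filter_subset _ _) ?_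
        intro x hx
        exact (Finset.mem_filter.1 hx).2.2
    calc (Γ.biUnion bd).card * g * A.card ≤ (∑ χ ∈ Γ, (bd χ).card) * g * A.card := by
          gcongr; exact Finset.card_biUnion_le
      _ = ∑ χ ∈ Γ, (bd χ).card * g * A.card := by rw [Finset.sum_mul, Finset.sum_mul]
      _ ≤ Γ.card • (B ^ 2 * Nat.card G * X2.card) := Finset.sum_le_card_nsmul _ _ _ h1
      _ = _ := by simp
  · intro x hx hxb χ hχ hP
    by_contra hcon
    push Not at hcon
    exact hxb (Finset.mem_biUnion.2 ⟨χ, hχ, Finset.mem_filter.2 ⟨hx, hP, hcon⟩⟩)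

lemma coset_select {α : Type u} {β : Type v} [DecidableEq β] [DecidableEq α] (X2 bad : Finset α)
    (π : α → β)
    (n P B : ℕ) (h1 : n * (X2.image π).card ≤ P * X2.card) (h2 : 2 * B * bad.card < X2.card)
    (hb : bad ⊆ X2) (hn : 0 < n) :
    ∃ κ, n ≤ 2 * P * (X2.filter (π · = κ)).card ∧
      B * (bad.filter (π · = κ)).card ≤ (X2.filter (π · = κ)).card := by
  by_contra hcon
  push Not at hcon
  have hX2 : 0 < X2.card := by omega
  have hP : 0 < P := by
    have : 0 < (X2.image π).card := Finset.card_pos.2 ((Finset.card_pos.1 hX2).image π)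
    by_contra h
    have hP : P = 0 := by omega
    subst hP
    have := Nat.mul_pos hn this
    omega
  have h3 : ∀ κ ∈ X2.image π, 2 * P * (X2.filter (π · = κ)).card ≤
      n + 2 * P * (B * (bad.filter (π · = κ)).card) := by
    intro κ _
    by_cases h : n ≤ 2 * P * (X2.filter (π · = κ)).card
    · exact (Nat.mul_le_mul_left _ (hcon κ h).le).trans (Nat.le_add_left _ _)
    · omega
  have h4 := Finset.sum_le_sum h3
  rw [← Finset.mul_sum, ← Finset.card_eq_sum_card_image, Finset.sum_add_distrib,
    ← Finset.mul_sum, ← Finset.mul_sum] at h4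
  have h5 : ∑ κ ∈ X2.image π, (bad.filter (π · = κ)).card = bad.card := by
    rw [← Finset.card_eq_sum_card_fiberwise]
    intro x hx
    exact Finset.mem_image_of_mem π (hb hx)
  rw [h5] at h4
  simp only [Finset.sum_const, smul_eq_mul] at h4
  have h6 : 2 * P * X2.card ≤ P * X2.card + P * (2 * B * bad.card) := by nlinarith
  have h7 : P * (2 * B * bad.card) < P * X2.card := Nat.mul_lt_mul_of_pos_left h2 hP
  nlinarith

section mult
variable {R : Type u} [NonUnitalRing R]

open Classical in
/-- Left multiplication as an endomorphism of `T` (zero if it does not preserve `T`). -/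
noncomputable def lm (T : AddSubgroup R) (z : R) : T →+ T :=
  if h : ∀ t ∈ T, z * t ∈ T then
    { toFun := fun t => ⟨z * t, h t t.2⟩
      map_zero' := by simp
      map_add' := fun a b => by ext; simp [mul_add] }
  else 0

open Classical in
/-- Right multiplication as an endomorphism of `T` (zero if it does not preserve `T`). -/
noncomputable def rm (T : AddSubgroup R) (z : R) : T →+ T :=
  if h : ∀ t ∈ T, t * z ∈ T then
    { toFun := fun t => ⟨t * z, h t t.2⟩
      map_zero' := by simp
      map_add' := fun a b => by ext; simp [add_mul] }
  else 0

lemma lm_apply {T : AddSubgroup R} {z : R} (h : ∀ t ∈ T, z * t ∈ T) (t : T) :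
    ((lm T z t : T) : R) = z * t := by
  rw [lm, dif_pos h]; rfl

lemma rm_apply {T : AddSubgroup R} {z : R} (h : ∀ t ∈ T, t * z ∈ T) (t : T) :
    ((rm T z t : T) : R) = t * z := by
  rw [rm, dif_pos h]; rfl

lemma base_change {T : AddSubgroup R} [Finite T] {m : R → (T →+ T)} {X1 : Finset R}
    (hm : ∀ x ∈ X1, ∀ y ∈ X1, ∀ z ∈ X1, ∀ t, m (x - z) t = m (x - y) t + m (y - z) t)
    (χ : AddChar T ℂ) {x y x0 : R} (hx : x ∈ X1) (hy : y ∈ X1) (hx0 : x0 ∈ X1) :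
    χ.compAddMonoidHom (m (x - x0)) = χ.compAddMonoidHom (m (y - x0)) ↔
      ∀ t, χ (m (x - y) t) = 1 := by
  have hne : ∀ t : T, χ t ≠ 0 := fun t h => by
    have := AddChar.norm_apply χ t
    rw [h] at this; simp at this
  constructor
  · intro h t
    have h1 := DFunLike.congr_fun h t
    simp only [AddChar.compAddMonoidHom_apply] at h1
    rw [hm x hx y hy x0 hx0 t, AddChar.map_add_eq_mul] at h1
    exact mul_right_cancel₀ (hne _) (h1.trans (one_mul _).symm)
  · intro h
    ext t
    simp only [AddChar.compAddMonoidHom_apply]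
    rw [hm x hx y hy x0 hx0 t, AddChar.map_add_eq_mul, h t, one_mul]

end mult

end part6

section part7

lemma core (A C : ℕ) : ∃ M : ℕ, ∀ (R : Type u) [NonUnitalRing R] (T : AddSubgroup R) [Finite T]
    (Z : Set R) (X1 : Finset R) (D : Finset T), (∀ z ∈ Z, -z ∈ Z) → X1.Nonempty → D.Nonempty →
    Nat.card T ≤ A * D.card → (∀ x ∈ X1, ∀ y ∈ X1, x - y ∈ Z) →
    (∀ d ∈ D, ∀ d' ∈ D, (d : R) - d' ∈ Z) →
    (∀ x ∈ X1, ∀ y ∈ X1, ∀ t ∈ T, (x - y) * t ∈ T ∧ t * (x - y) ∈ T) →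
    Nat.card T * ((QuotientAddGroup.mk : R → R ⧸ T) '' (X1 : Set R)).ncard ≤ C * X1.card →
    (∀ x ∈ X1, ∀ y ∈ X1, Cov ({x - y} * (X1 : Set R)) Z C) →
    ∃ X2 ⊆ X1, X2.Nonempty ∧ X1.card ≤ M * X2.card ∧ ∃ J : AddSubgroup R, J ≤ T ∧
      (∀ x ∈ X2, ∀ y ∈ X2, ∀ t ∈ T, (x - y) * t ∈ J ∧ t * (x - y) ∈ J) ∧
      ∀ u ∈ J, u ∈ (Z + Z + Z + Z) + Z * (Z + Z + Z + Z) := by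
  obtain ⟨B, hB⟩ : ∃ B, B = 32 * A ^ 3 := ⟨_, rfl⟩
  obtain ⟨g, hg⟩ : ∃ g : ℕ → ℕ, g = fun M => 8 * A ^ 4 * B ^ 3 + 8 * A ^ 3 * B ^ 2 * C ^ 2 * M + 1 :=
    ⟨_, rfl⟩
  obtain ⟨M0, hM0⟩ := refine_pop.{u} g (8 * A ^ 3)
  refine ⟨M0, fun R _ T _ Z X1 D hZs hX1 hD hTD hXZ hDZ hmul hcos hcov => ?_⟩
  classical
  obtain ⟨x1, hx1⟩ := hX1
  have hZ0 : (0 : R) ∈ Z := by simpa using hXZ x1 hx1 x1 hx1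
  have hTpos : 0 < Nat.card T := Nat.card_pos
  have hDpos := hD.card_pos
  have hdR : (0 : ℝ) < D.card := by exact_mod_cast hDpos
  set Γ : Finset (AddChar T ℂ) :=
    Finset.univ.filter (fun χ => (D.card : ℝ) ≤ (2 * A : ℕ) * ‖∑ d ∈ D, χ d‖) with hΓd
  have hΓc : Γ.card ≤ 4 * A ^ 3 := by
    have h1 := largecount D hD (2 * A) Γ (fun ψ hψ => (Finset.mem_filter.1 hψ).2)
    have h2 : Γ.card * D.card ≤ (4 * A ^ 3) * D.card := by
      calc _ ≤ _ := h1
        _ ≤ (2 * A) ^ 2 * (A * D.card) := Nat.mul_le_mul_left _ hTD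
        _ = _ := by ring
    exact Nat.le_of_mul_le_mul_right h2 hDpos
  have hl : ∀ x ∈ X1, ∀ y ∈ X1, ∀ t : T, ((lm T (x - y) t : T) : R) = (x - y) * t :=
    fun x hx y hy t => lm_apply (fun t ht => (hmul x hx y hy t ht).1) t
  have hr : ∀ x ∈ X1, ∀ y ∈ X1, ∀ t : T, ((rm T (x - y) t : T) : R) = t * (x - y) :=
    fun x hx y hy t => rm_apply (fun t ht => (hmul x hx y hy t ht).2) t
  have hlm : ∀ x ∈ X1, ∀ y ∈ X1, ∀ z ∈ X1, ∀ t,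
      lm T (x - z) t = lm T (x - y) t + lm T (y - z) t := by
    intro x hx y hy z hz t
    ext
    rw [AddSubgroup.coe_add, hl x hx z hz, hl x hx y hy, hl y hy z hz, ← add_mul]
    congr 1; abel
  have hrm : ∀ x ∈ X1, ∀ y ∈ X1, ∀ z ∈ X1, ∀ t,
      rm T (x - z) t = rm T (x - y) t + rm T (y - z) t := by
    intro x hx y hy z hz t
    ext
    rw [AddSubgroup.coe_add, hr x hx z hz, hr x hx y hy, hr y hy z hz, ← mul_add]
    congr 1; abel
  -- the refinement
  obtain ⟨X2, hX21, hX2ne, M, hM, hX1M, hI⟩ := hM0 R (AddChar T ℂ) (AddChar T ℂ × Bool)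
    (Γ ×ˢ Finset.univ)
    (fun p x => p.1.compAddMonoidHom (if p.2 then lm T (x - x1) else rm T (x - x1))) X1
    (by rw [Finset.card_product]; simp; omega) ⟨x1, hx1⟩
  have hX2pos := hX2ne.card_pos
  let PL : AddChar T ℂ → Prop := fun χ => ∀ x ∈ X2, ∀ y ∈ X2, ∀ t, χ (lm T (x - y) t) = 1
  let PR : AddChar T ℂ → Prop := fun χ => ∀ x ∈ X2, ∀ y ∈ X2, ∀ t, χ (rm T (x - y) t) = 1
  have hspL : ∀ x0 ∈ X1, ∀ χ ∈ Γ, ¬ PL χ → ∀ y ∈ X2, ∀ S ⊆ X2,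
      (∀ x ∈ S, χ.compAddMonoidHom (lm T (x - x0)) = χ.compAddMonoidHom (lm T (y - x0))) →
      g M * S.card ≤ X2.card := by
    intro x0 hx0 χ hχ hP y hy S hS hSf
    rcases hI (χ, true) (by simp [hχ]) with h | h
    · exfalso
      apply hP
      intro x hx y hy
      exact (base_change hlm χ (hX21 hx) (hX21 hy) hx1).1 (by simpa using h x hx y hy)
    · refine h y hy S hS fun x hx => ?_
      have h1 := (base_change hlm χ (hX21 (hS hx)) (hX21 hy) hx0).1 (hSf x hx)
      simpa using (base_change hlm χ (hX21 (hS hx)) (hX21 hy) hx1).2 h1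
  have hspR : ∀ x0 ∈ X1, ∀ χ ∈ Γ, ¬ PR χ → ∀ y ∈ X2, ∀ S ⊆ X2,
      (∀ x ∈ S, χ.compAddMonoidHom (rm T (x - x0)) = χ.compAddMonoidHom (rm T (y - x0))) →
      g M * S.card ≤ X2.card := by
    intro x0 hx0 χ hχ hP y hy S hS hSf
    rcases hI (χ, false) (by simp [hχ]) with h | h
    · exfalso
      apply hP
      intro x hx y hy
      exact (base_change hrm χ (hX21 hx) (hX21 hy) hx1).1 (by simpa using h x hx y hy)
    · refine h y hy S hS fun x hx => ?_
      have h1 := (base_change hrm χ (hX21 (hS hx)) (hX21 hy) hx0).1 (hSf x hx)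
      simpa using (base_change hrm χ (hX21 (hS hx)) (hX21 hy) hx1).2 h1
  clear hI hM0
  -- the subgroup J
  let J : AddSubgroup R :=
    { carrier := {r | ∃ h : r ∈ T, ∀ χ ∈ Γ, PL χ → PR χ → χ ⟨r, h⟩ = 1}
      zero_mem' := ⟨T.zero_mem, fun χ _ _ _ => AddChar.map_zero_eq_one χ⟩
      add_mem' := by
        rintro a b ⟨ha, ha'⟩ ⟨hb, hb'⟩
        refine ⟨T.add_mem ha hb, fun χ h1 h2 h3 => ?_⟩
        have : (⟨a + b, T.add_mem ha hb⟩ : T) = ⟨a, ha⟩ + ⟨b, hb⟩ := rfl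
        rw [this, AddChar.map_add_eq_mul, ha' χ h1 h2 h3, hb' χ h1 h2 h3, one_mul]
      neg_mem' := by
        rintro a ⟨ha, ha'⟩
        refine ⟨T.neg_mem ha, fun χ h1 h2 h3 => ?_⟩
        have : (⟨-a, T.neg_mem ha⟩ : T) = -⟨a, ha⟩ := rfl
        rw [this, AddChar.map_neg_eq_conj, ha' χ h1 h2 h3, map_one] }
  refine ⟨X2, hX21, hX2ne, hX1M.trans (Nat.mul_le_mul_right _ hM), J, fun r hr => hr.1, ?_, ?_⟩
  · intro x hx y hy t ht
    constructor
    · refine ⟨(hmul x (hX21 hx) y (hX21 hy) t ht).1, fun χ _ h2 _ => ?_⟩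
      have h4 := h2 x hx y hy ⟨t, ht⟩
      rw [← h4]
      congr 1
      ext
      rw [hl x (hX21 hx) y (hX21 hy)]
    · refine ⟨(hmul x (hX21 hx) y (hX21 hy) t ht).2, fun χ _ _ h3 => ?_⟩
      have h4 := h3 x hx y hy ⟨t, ht⟩
      rw [← h4]
      congr 1
      ext
      rw [hr x (hX21 hx) y (hX21 hy)]
  · rintro u ⟨huT, huΓ⟩
    obtain ⟨x0, hx0⟩ := hX2ne
    have hx01 := hX21 hx0
    -- bad elements on the left
    obtain ⟨bad, hbad2, hbadc, hbadP⟩ := badunion X2 Γ PL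
      (fun χ x => χ.compAddMonoidHom (lm T (x - x0))) (g M) (hspL x0 hx01) D hD B
    have hbadc2 : 2 * B * bad.card < X2.card := by
      have h1 : bad.card * g M * D.card ≤ (4 * A ^ 3 * (B ^ 2 * A * X2.card)) * D.card := by
        calc _ ≤ _ := hbadc
          _ ≤ (4 * A ^ 3) * (B ^ 2 * (A * D.card) * X2.card) := by gcongr
          _ = _ := by ring
      have h2 := Nat.le_of_mul_le_mul_right h1 hDpos
      have h3 : 8 * A ^ 4 * B ^ 3 < g M := by
        rw [hg]; simp only []; have := Nat.zero_le (8 * A ^ 3 * B ^ 2 * C ^ 2 * M); omega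
      by_contra hcon
      push Not at hcon
      have h4 : X2.card * g M ≤ X2.card * (8 * A ^ 4 * B ^ 3) := by
        calc X2.card * g M ≤ 2 * B * bad.card * g M := Nat.mul_le_mul_right _ hcon
          _ = 2 * B * (bad.card * g M) := by ring
          _ ≤ 2 * B * (4 * A ^ 3 * (B ^ 2 * A * X2.card)) := Nat.mul_le_mul_left _ h2
          _ = _ := by ring
      have := Nat.le_of_mul_le_mul_left h4 hX2pos
      omega
    -- the coset
    obtain ⟨κ, hκ1, hκ2⟩ := coset_select X2 bad (QuotientAddGroup.mk : R → R ⧸ T) (Nat.card T)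
      (C * M) B (by
        have h1 : (X2.image (QuotientAddGroup.mk : R → R ⧸ T)).card ≤
            ((QuotientAddGroup.mk : R → R ⧸ T) '' (X1 : Set R)).ncard := by
          rw [← Set.ncard_coe_finset, Finset.coe_image]
          exact Set.ncard_le_ncard (Set.image_mono (by exact_mod_cast hX21))
            (X1.finite_toSet.image _)
        calc _ ≤ _ := Nat.mul_le_mul_left _ h1
          _ ≤ _ := hcos
          _ ≤ C * (M * X2.card) := Nat.mul_le_mul_left _ hX1M
          _ = _ := by ring) hbadc2 hbad2 hTpos
    set E := X2.filter (fun x => (QuotientAddGroup.mk : R → R ⧸ T) x = κ) with hE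
    have hEpos : 0 < E.card := by
      by_contra h
      have : E.card = 0 := by omega
      rw [this] at hκ1; omega
    have hE2 : ∀ x ∈ E, x ∈ X2 := fun x hx => (Finset.mem_filter.1 hx).1
    obtain ⟨xs, hxs⟩ := Finset.card_pos.1 hEpos
    have hEs : ∀ x ∈ E, x - xs ∈ T := by
      intro x hx
      have h1 := (Finset.mem_filter.1 hx).2
      have h2 := (Finset.mem_filter.1 hxs).2
      have h3 := QuotientAddGroup.eq.1 (h2.trans h1.symm)
      rwa [neg_add_eq_sub] at h3
    let tx : R → T := fun x => if h : x - xs ∈ T then ⟨x - xs, h⟩ else 0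
    have htx : ∀ x ∈ E, ((tx x : T) : R) = x - xs := fun x hx => by
      simp only [tx, dif_pos (hEs x hx)]
    have htxinj : Set.InjOn tx (E : Set R) := by
      intro x hx y hy h
      have := congrArg (fun t : T => (t : R)) h
      rw [htx x hx, htx y hy] at this
      exact sub_left_injective this
    let E' := E.image tx
    have hE'c : E'.card = E.card := Finset.card_image_of_injOn htxinj
    have hE'ne : E'.Nonempty := Finset.card_pos.1 (by omega)
    -- classes for y
    obtain ⟨F, hF, hFc⟩ := hcov xs (hX21 (hE2 xs hxs)) x0 hx01
    have hFc' : ∀ y ∈ X2, ∃ f ∈ F, (xs - x0) * y - f ∈ Z := fun y hy =>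
      hFc _ ⟨_, rfl, y, hX21 hy, rfl⟩
    choose! cl hcl hclZ using hFc'
    obtain ⟨f0, hf0, hf0c⟩ : ∃ f ∈ F, X2.card ≤ C * (X2.filter (cl · = f)).card := by
      by_contra hcon
      push Not at hcon
      have h1 := Finset.card_eq_sum_card_fiberwise (f := cl) (s := X2) (t := F) (fun y hy => hcl y hy)
      have hFne : F.Nonempty := ⟨_, hcl x0 hx0⟩
      have h2 : ∑ f ∈ F, C * (X2.filter (cl · = f)).card < ∑ f ∈ F, X2.card :=
        Finset.sum_lt_sum_of_nonempty hFne hcon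
      rw [← Finset.mul_sum, ← h1, Finset.sum_const, smul_eq_mul] at h2
      exact absurd (Nat.mul_le_mul_right X2.card hF) (by omega)
    obtain ⟨y0, hy0⟩ : (X2.filter (cl · = f0)).Nonempty := by
      rw [← Finset.card_pos]
      by_contra h
      have : (X2.filter (cl · = f0)).card = 0 := by omega
      rw [this] at hf0c; omega
    have hy02 := (Finset.mem_filter.1 hy0).1
    obtain ⟨bad', hbad'2, hbad'c, hbad'P⟩ := badunion X2 Γ PR
      (fun χ x => χ.compAddMonoidHom (rm T (x - y0))) (g M) (hspR y0 (hX21 hy02)) E' hE'ne B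
    have hbad'c2 : C * bad'.card < X2.card := by
      have h1 : bad'.card * g M * E.card ≤ (4 * A ^ 3 * (B ^ 2 * (2 * (C * M)) * X2.card)) * E.card := by
        calc bad'.card * g M * E.card = bad'.card * g M * E'.card := by rw [hE'c]
          _ ≤ _ := hbad'c
          _ ≤ (4 * A ^ 3) * (B ^ 2 * (2 * (C * M) * E.card) * X2.card) := by gcongr
          _ = _ := by ring
      have h2 := Nat.le_of_mul_le_mul_right h1 hEpos
      have h3 : 8 * A ^ 3 * B ^ 2 * C ^ 2 * M < g M := by
        rw [hg]; simp only []; have := Nat.zero_le (8 * A ^ 4 * B ^ 3); omega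
      by_contra hcon
      push Not at hcon
      have h4 : X2.card * g M ≤ X2.card * (8 * A ^ 3 * B ^ 2 * C ^ 2 * M) := by
        calc X2.card * g M ≤ C * bad'.card * g M := Nat.mul_le_mul_right _ hcon
          _ = C * (bad'.card * g M) := by ring
          _ ≤ C * (4 * A ^ 3 * (B ^ 2 * (2 * (C * M)) * X2.card)) := Nat.mul_le_mul_left _ h2
          _ = _ := by ring
      have := Nat.le_of_mul_le_mul_left h4 hX2pos
      omega
    obtain ⟨y, hy, hyb⟩ : ∃ y ∈ X2.filter (cl · = f0), y ∉ bad' := by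
      by_contra hcon
      push Not at hcon
      have h1 := Finset.card_le_card (show X2.filter (cl · = f0) ⊆ bad' from hcon)
      have h2 := Nat.mul_le_mul_left C h1
      omega
    have hy2 := (Finset.mem_filter.1 hy).1
    have hbb : (xs - x0) * (y - y0) ∈ Z + Z := by
      have h1 := hclZ y hy2
      have h2 := hclZ y0 hy02
      rw [(Finset.mem_filter.1 hy).2] at h1
      rw [(Finset.mem_filter.1 hy0).2] at h2
      refine ⟨_, h1, _, hZs _ h2, ?_⟩
      simp only [mul_sub]; abel
    obtain ⟨d0, hd0⟩ := hD
    obtain ⟨d1, hd1, d2, hd2, d3, hd3, d4, hd4, x, hx, t, ht, hu⟩ := analytic D ⟨d0, hd0⟩ A hTD E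
      ⟨xs, hxs⟩ (fun x t => lm T (x - x0) (t - d0) + rm T (y - y0) (tx x)) ⟨u, huT⟩ (by
      intro χ hχ
      have hχΓ : χ ∈ Γ := Finset.mem_filter.2 ⟨Finset.mem_univ _, hχ⟩
      by_cases hL : PL χ
      · by_cases hR : PR χ
        · left
          refine ⟨huΓ χ hχΓ hL hR, fun x hx t _ => ?_⟩
          rw [AddChar.map_add_eq_mul, hL x (hE2 x hx) x0 hx0, hR y hy2 y0 hy02, one_mul]
        · right
          have h1 := hbad'P y hy2 hyb χ hχΓ hR
          have h2 : ∑ x ∈ E, ∑ t ∈ D, χ (lm T (x - x0) (t - d0) + rm T (y - y0) (tx x)) =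
              (D.card : ℂ) * ∑ a ∈ E', χ.compAddMonoidHom (rm T (y - y0)) a := by
            rw [Finset.sum_image htxinj, Finset.mul_sum]
            refine Finset.sum_congr rfl fun x hx => ?_
            have : ∀ t ∈ D, χ (lm T (x - x0) (t - d0) + rm T (y - y0) (tx x)) =
                χ.compAddMonoidHom (rm T (y - y0)) (tx x) := fun t _ => by
              rw [AddChar.map_add_eq_mul, hL x (hE2 x hx) x0 hx0, one_mul]; rfl
            rw [Finset.sum_congr rfl this]
            simp
          rw [h2, norm_mul, Complex.norm_natCast]
          have hB2 : (B : ℝ) = 32 * A ^ 3 := by rw [hB]; push_cast; ring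
          rw [hE'c, hB2] at h1
          have h3 := mul_le_mul_of_nonneg_left h1.le hdR.le
          have h4 : 0 ≤ (D.card : ℝ) * ((16 * A ^ 3) * ‖∑ a ∈ E', χ.compAddMonoidHom (rm T (y - y0)) a‖) := by
            positivity
          linarith
      · right
        have h1 : ∀ x ∈ E, ‖∑ t ∈ D, χ (lm T (x - x0) (t - d0) + rm T (y - y0) (tx x))‖ =
            ‖∑ t ∈ D, χ.compAddMonoidHom (lm T (x - x0)) t‖ := by
          intro x hx
          have : ∑ t ∈ D, χ (lm T (x - x0) (t - d0) + rm T (y - y0) (tx x)) =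
            (∑ t ∈ D, χ.compAddMonoidHom (lm T (x - x0)) t) *
              χ (-(lm T (x - x0) d0) + rm T (y - y0) (tx x)) := by
            rw [Finset.sum_mul]
            refine Finset.sum_congr rfl fun t _ => ?_
            rw [AddChar.compAddMonoidHom_apply, ← AddChar.map_add_eq_mul, map_sub]
            congr 1; abel
          rw [this, norm_mul, AddChar.norm_apply, mul_one]
        have h2 : (B : ℝ) * ‖∑ x ∈ E, ∑ t ∈ D, χ (lm T (x - x0) (t - d0) + rm T (y - y0) (tx x))‖
            ≤ 2 * (E.card * D.card) := by
          calc _ ≤ (B : ℝ) * ∑ x ∈ E, ‖∑ t ∈ D, χ.compAddMonoidHom (lm T (x - x0)) t‖ := by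
                gcongr
                refine (norm_sum_le _ _).trans (le_of_eq (Finset.sum_congr rfl h1))
            _ = ∑ x ∈ E, (B : ℝ) * ‖∑ t ∈ D, χ.compAddMonoidHom (lm T (x - x0)) t‖ := Finset.mul_sum _ _ _
            _ ≤ ∑ x ∈ E, ((D.card : ℝ) + if x ∈ bad then (B : ℝ) * D.card else 0) := by
                refine Finset.sum_le_sum fun x hx => ?_
                by_cases hxb : x ∈ bad
                · rw [if_pos hxb]
                  have := norm_charsum_le (χ.compAddMonoidHom (lm T (x - x0))) D id
                  simp only [id] at this
                  have h3 : (B : ℝ) * ‖∑ t ∈ D, χ.compAddMonoidHom (lm T (x - x0)) t‖ ≤ B * D.card := by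
                    gcongr
                  linarith
                · rw [if_neg hxb, add_zero]
                  exact (hbadP x (hE2 x hx) hxb χ hχΓ hL).le
            _ = E.card * D.card + ((E.filter (· ∈ bad)).card : ℝ) * (B * D.card) := by
                rw [Finset.sum_add_distrib, ← Finset.sum_filter]
                simp only [Finset.sum_const, nsmul_eq_mul]
            _ ≤ E.card * D.card + E.card * D.card := by
                have h3 : B * (E.filter (· ∈ bad)).card ≤ E.card := by
                  refine le_trans (Nat.mul_le_mul_left _ (Finset.card_le_card ?_)) hκ2
                  intro x hx
                  have h5 := Finset.mem_filter.1 hx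
                  exact Finset.mem_filter.2 ⟨h5.2, (Finset.mem_filter.1 h5.1).2⟩
                have h4 : (B : ℝ) * ((E.filter (· ∈ bad)).card : ℝ) ≤ E.card := by exact_mod_cast h3
                nlinarith
            _ = _ := by ring
        rw [hB] at h2
        push_cast at h2
        linarith)
    have hu' := congrArg (fun t : T => (t : R)) hu
    simp only [AddSubgroup.coe_add, AddSubgroup.coe_sub] at hu'
    rw [hl x (hX21 (hE2 x hx)) x0 hx01, hr y (hX21 hy2) y0 (hX21 hy02), htx x hx] at hu'
    obtain ⟨z1, hz1, z2, hz2, hzz⟩ := hbb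
    refine ⟨_, ⟨_, ⟨_, ⟨_, hDZ d1 hd1 d3 hd3, _, hDZ d2 hd2 d4 hd4, rfl⟩, -z1, hZs _ hz1, rfl⟩,
      -z2, hZs _ hz2, rfl⟩, _, ⟨_, hXZ x (hX21 (hE2 x hx)) x0 hx01, _,
      ⟨_, ⟨_, ⟨_, hDZ t ht d0 hd0, _, hXZ y (hX21 hy2) y0 (hX21 hy02), rfl⟩, 0, hZ0, rfl⟩, 0, hZ0, rfl⟩,
      rfl⟩, ?_⟩
    simp only [] at hzz ⊢
    have e1 : (d1 : R) - d3 + (d2 - d4) + -z1 + -z2 = (d1 : R) + d2 - d3 - d4 - (xs - x0) * (y - y0) := by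
      rw [← hzz]; abel
    rw [e1, hu']
    simp only [AddSubgroup.coe_sub, sub_mul, mul_sub, mul_add, add_zero]
    abel

end part7

section part8

lemma pigeon1 {R : Type u} [AddCommGroup R] {α : Type v} (X : Finset α) (hX : X.Nonempty) (g : α → R)
    (B : Set R) (N : ℕ) (h : Cov (g '' (X : Set α)) B N) :
    ∃ X1 ⊆ X, X1.Nonempty ∧ X.card ≤ N * X1.card ∧ ∃ f : R, ∀ x ∈ X1, g x - f ∈ B := by
  classical
  obtain ⟨F, hF, h⟩ := h
  have h' : ∀ x : α, ∃ f : R, x ∈ X → f ∈ F ∧ g x - f ∈ B := by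
    intro x
    by_cases hx : x ∈ X
    · obtain ⟨f, hf, hh⟩ := h (g x) ⟨x, hx, rfl⟩
      exact ⟨f, fun _ => ⟨hf, hh⟩⟩
    · exact ⟨0, fun hh => absurd hh hx⟩
  choose σ hσ using h'
  have hmap : ∀ x ∈ X, σ x ∈ F := fun x hx => (hσ x hx).1
  have hFne : F.Nonempty := by
    obtain ⟨x, hx⟩ := hX
    exact ⟨_, hmap x hx⟩
  obtain ⟨f, hf, hmax⟩ := F.exists_max_image (fun f => (X.filter (fun x => σ x = f)).card) hFne
  have hcard : X.card ≤ N * (X.filter (fun x => σ x = f)).card := by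
    rw [Finset.card_eq_sum_card_fiberwise hmap]
    refine (Finset.sum_le_card_nsmul _ _ _ hmax).trans ?_
    rw [smul_eq_mul]
    exact Nat.mul_le_mul_right _ hF
  refine ⟨X.filter (fun x => σ x = f), Finset.filter_subset _ _, ?_, hcard, f, ?_⟩
  · rw [← Finset.card_pos]
    by_contra h0
    have : X.card ≤ 0 := by simpa [Nat.eq_zero_of_not_pos h0] using hcard
    exact absurd (Finset.card_pos.2 hX) (by omega)
  · intro x hx
    obtain ⟨h1, h2⟩ := Finset.mem_filter.1 hx
    rw [← h2]
    exact (hσ x h1).2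

lemma pigeon {R : Type u} [AddCommGroup R] {α : Type v} {ι : Type v} [DecidableEq ι]
    (g : ι → α → R) (B : Set R) (N : ℕ) (F : Finset ι) : ∀ (X : Finset α), X.Nonempty →
    (∀ i ∈ F, Cov (g i '' (X : Set α)) B N) →
    ∃ X1 ⊆ X, X1.Nonempty ∧ X.card ≤ N ^ F.card * X1.card ∧
      ∀ i ∈ F, ∀ x ∈ X1, ∀ y ∈ X1, g i x - g i y ∈ B - B := by
  induction F using Finset.induction_on with
  | empty => exact fun X hX _ => ⟨X, subset_rfl, hX, by simp, by simp⟩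
  | insert i F hi ih =>
    intro X hX h
    obtain ⟨X1, hs, hne, hc, h1⟩ := ih X hX fun j hj => h j (Finset.mem_insert_of_mem hj)
    obtain ⟨X2, hs2, hne2, hc2, f, hf⟩ := pigeon1 X1 hne (g i) B N
      ((h i (Finset.mem_insert_self _ _)).mono (Set.image_mono (by exact_mod_cast hs)) subset_rfl le_rfl)
    refine ⟨X2, hs2.trans hs, hne2, ?_, ?_⟩
    · rw [Finset.card_insert_of_notMem hi, pow_succ, mul_assoc]
      exact hc.trans (Nat.mul_le_mul_left _ hc2)
    · intro j hj x hx y hy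
      rcases Finset.mem_insert.1 hj with rfl | hj
      · exact ⟨_, hf x hx, _, hf y hy, by simp⟩
      · exact h1 j hj x (hs2 hx) y (hs2 hy)

lemma coset_count {R : Type u} [AddCommGroup R] (T : AddSubgroup R) [Finite T] (X1 : Finset R)
    (S : Set R) (hS : S.Finite) (h : ∀ t ∈ T, ∀ x ∈ X1, t + x ∈ S) :
    Nat.card T * ((QuotientAddGroup.mk : R → R ⧸ T) '' (X1 : Set R)).ncard ≤ S.ncard := by
  classical
  set Q := (QuotientAddGroup.mk : R → R ⧸ T) '' (X1 : Set R) with hQ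
  have hc : ∀ q : Q, ∃ x, x ∈ X1 ∧ (QuotientAddGroup.mk x : R ⧸ T) = q := fun q => by
    obtain ⟨x, hx, hh⟩ := q.2
    exact ⟨x, hx, hh⟩
  choose σ hσ hσ' using hc
  have : Finite S := hS
  rw [← Nat.card_coe_set_eq Q, ← Nat.card_coe_set_eq S, ← Nat.card_prod]
  refine Nat.card_le_card_of_injective
    (fun p : T × Q => (⟨(p.1 : R) + σ p.2, h _ p.1.2 _ (hσ p.2)⟩ : S)) ?_
  rintro ⟨t, q⟩ ⟨t', q'⟩ hh
  have h1 : (t : R) + σ q = t' + σ q' := congrArg Subtype.val hh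
  have hq : q = q' := by
    apply Subtype.ext
    rw [← hσ', ← hσ', QuotientAddGroup.eq]
    have : -σ q + σ q' = (t : R) - t' := by
      rw [← sub_eq_zero] at h1 ⊢
      rw [← neg_eq_zero, ← h1]
      abel
    rw [this]
    exact T.sub_mem t.2 t'.2
  subst hq
  have : t = t' := Subtype.ext (by simpa using h1)
  rw [this]

lemma exists_D {R : Type u} [AddCommGroup R] (T : AddSubgroup R) [Finite T] (X : Finset R)
    (hX : X.Nonempty) (A : ℕ) (S : Set R) (hS : S.Finite) (h : ∀ t ∈ T, ∀ x ∈ X, t - x ∈ S)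
    (hc : S.ncard ≤ A * X.card) :
    ∃ D : Finset T, D.Nonempty ∧ Nat.card T ≤ A * D.card ∧
      ∀ d ∈ D, ∀ d' ∈ D, (d : R) - d' ∈ (X : Set R) - (X : Set R) := by
  classical
  have := Fintype.ofFinite T
  obtain ⟨X1, hs, hne, hcard, f, hf⟩ := pigeon1 (R := R) ((Finset.univ : Finset T) ×ˢ X)
    (Finset.univ_nonempty.product hX) (fun p => (p.1 : R) - p.2) {0} S.ncard (by
      refine ⟨hS.toFinset, by rw [Set.ncard_eq_toFinset_card _ hS], ?_⟩
      rintro _ ⟨⟨t, x⟩, hp, rfl⟩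
      refine ⟨_, hS.mem_toFinset.2 (h t t.2 x ?_), by simp⟩
      simpa using hp)
  have hX' := Finset.card_pos.2 hX
  have hinj : Set.InjOn (fun p : T × R => p.1) (X1 : Set (T × R)) := by
    rintro ⟨t, x⟩ hp ⟨t', x'⟩ hp' hh
    have h1 := hf _ hp
    have h2 := hf _ hp'
    simp only [Set.mem_singleton_iff] at h1 h2
    simp only at hh
    subst hh
    have h3 : x = x' := by
      rw [sub_eq_zero] at h1 h2
      have := h1.trans h2.symm
      simpa using this
    rw [h3]
  refine ⟨X1.image (fun p => p.1), hne.image _, ?_, ?_⟩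
  · rw [Finset.card_image_of_injOn hinj]
    rw [Finset.card_product, Finset.card_univ, ← Nat.card_eq_fintype_card] at hcard
    have := hcard.trans (Nat.mul_le_mul_right _ hc)
    refine Nat.le_of_mul_le_mul_right (c := X.card) ?_ hX'
    nlinarith
  · intro d hd d' hd'
    obtain ⟨⟨t, x⟩, hp, rfl⟩ := Finset.mem_image.1 hd
    obtain ⟨⟨t', x'⟩, hp', rfl⟩ := Finset.mem_image.1 hd'
    have h1 := hf _ hp
    have h2 := hf _ hp'
    simp only [Set.mem_singleton_iff] at h1 h2
    have hx := hs hp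
    have hx' := hs hp'
    simp only [Finset.mem_product] at hx hx'
    refine ⟨x, hx.2, x', hx'.2, ?_⟩
    simp only
    rw [sub_eq_zero] at h1 h2
    have := h1.trans h2.symm
    rw [sub_eq_sub_iff_sub_eq_sub] at this
    exact this.symm

theorem step5 (L n : ℕ) : ∃ M : ℕ, ∀ (R : Type u) [NonUnitalRing R] (X : Set R), Good X L →
    ∀ T : AddSubgroup R, (T : Set R) ⊆ iterX (X - X) n →
    (∀ H : AddSubgroup R, (H : Set R) ⊆ iterX (X - X) 3 → H ≤ T) →
    ∃ X2 : Finset R, (X2 : Set R) ⊆ X ∧ X2.Nonempty ∧ X.ncard ≤ M * X2.card ∧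
      ∃ J : AddSubgroup R, J ≤ T ∧
        (∀ x ∈ X2, ∀ y ∈ X2, ∀ t ∈ T, (x - y) * t ∈ J ∧ t * (x - y) ∈ J) ∧
        ∀ u ∈ J, u ∈ ((X - X) + (X - X) + (X - X) + (X - X)) +
          (X - X) * ((X - X) + (X - X) + (X - X) + (X - X)) := by
  classical
  obtain ⟨M1, hM1⟩ := iter_cov.{u} L n
  obtain ⟨M2, hM2⟩ := iter_cov.{u} L 0
  obtain ⟨N, hN⟩ : ∃ N, N = (M1 + 1) ^ M1 * (M1 + 1) ^ M1 := ⟨_, rfl⟩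
  obtain ⟨M, hM⟩ := core.{u} (M1 * L * L) (M1 * L * L * N + M2)
  refine ⟨N * M, ?_⟩
  intro R _ X hg T hT hTmax
  obtain ⟨hcovn, hmuln⟩ := hM1 R X hg
  obtain ⟨-, hmul0⟩ := hM2 R X hg
  have h0 := hg.zero
  have hZfin : (X - X).Finite := hg.fin.sub hg.fin
  have hTfin : (T : Set R).Finite := (iterX_finite hZfin n).subset hT
  have hTF : Finite T := hTfin
  have hcT : Cov (T : Set R) (X - X) M1 := hcovn.mono hT subset_rfl le_rfl
  obtain ⟨F, hFc, hFT, hF⟩ := hcT.inside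
  rw [subZ_eq] at hF
  lift X to Finset R using hg.fin with X' hX'
  have hXne : X'.Nonempty := by exact_mod_cast hg.ne
  -- pigeonhole on left and right multiplications
  obtain ⟨Xa, hsa, hnea, hca, ha⟩ := pigeon (fun f x : R => x * f) ((X' : Set R) - (X' : Set R)) (M1 + 1) F X'
    hXne (fun f hf => (hmuln f (hT (hFT hf))).1.mono (by
      rintro _ ⟨x, hx, rfl⟩; exact ⟨x, hx, f, rfl, rfl⟩) subset_rfl (by omega))
  obtain ⟨X1, hs1, hne1, hc1, hb⟩ := pigeon (fun f x : R => f * x) ((X' : Set R) - (X' : Set R)) (M1 + 1) F Xa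
    hnea (fun f hf => (hmuln f (hT (hFT hf))).2.mono (by
      rintro _ ⟨x, hx, rfl⟩; exact ⟨f, rfl, x, hsa hx, rfl⟩) subset_rfl (by omega))
  have hs : X1 ⊆ X' := hs1.trans hsa
  have hcard1 : X'.card ≤ N * X1.card := by
    calc X'.card ≤ (M1 + 1) ^ F.card * ((M1 + 1) ^ F.card * X1.card) :=
          hca.trans (Nat.mul_le_mul_left _ hc1)
      _ ≤ (M1 + 1) ^ M1 * ((M1 + 1) ^ M1 * X1.card) := by
          gcongr <;> omega
      _ = N * X1.card := by rw [hN, mul_assoc]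
  have hd1 : ∀ x ∈ X1, ∀ y ∈ X1, x - y ∈ (X' : Set R) - (X' : Set R) := fun x hx y hy =>
    ⟨x, hs hx, y, hs hy, rfl⟩
  have h2Z : ∀ z ∈ ((X' : Set R) - (X' : Set R)) + ((X' : Set R) - (X' : Set R)), z ∈ iterX ((X' : Set R) - (X' : Set R)) 1 := by
    intro z hz
    have : z ∈ ms ((X' : Set R) - (X' : Set R)) 1 + ms ((X' : Set R) - (X' : Set R)) 1 := by rwa [ms_one]
    rw [← ms_add] at this
    obtain ⟨a, ha, b, hb, rfl⟩ := hz
    exact iterX_add h0 0 ha hb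
  have hTst : ∀ x ∈ X1, ∀ y ∈ X1, ∀ t ∈ T, (x - y) * t ∈ T ∧ t * (x - y) ∈ T := by
    intro x hx y hy t ht
    have hz := iterX_mono h0 (show 0 ≤ 1 by omega) (hd1 x hx y hy)
    constructor
    · refine hTmax (T.map (AddMonoidHom.mulLeft (x - y))) ?_ ⟨t, ht, rfl⟩
      rintro _ ⟨s, hs', rfl⟩
      obtain ⟨f, hf, hff⟩ := hF s hs'
      have e : (x - y) * s = (x * f - y * f) + (x - y) * (s - f) := by
        rw [mul_sub, ← sub_mul]; abel
      change (x - y) * s ∈ _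
      rw [e]
      refine iterX_add h0 2 ?_ (iterX_mul h0 1 hz (h2Z _ hff))
      have := ha f hf x (hs1 hx) y (hs1 hy)
      rw [subZ_eq] at this
      exact iterX_mono h0 (show 1 ≤ 2 by omega) (h2Z _ this)
    · refine hTmax (T.map (AddMonoidHom.mulRight (x - y))) ?_ ⟨t, ht, rfl⟩
      rintro _ ⟨s, hs', rfl⟩
      obtain ⟨f, hf, hff⟩ := hF s hs'
      have e : s * (x - y) = (f * x - f * y) + (s - f) * (x - y) := by
        rw [sub_mul, ← mul_sub]; abel
      change s * (x - y) ∈ _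
      rw [e]
      refine iterX_add h0 2 ?_ (iterX_mul h0 1 (h2Z _ hff) hz)
      have := hb f hf x hx y hy
      rw [subZ_eq] at this
      exact iterX_mono h0 (show 1 ≤ 2 by omega) (h2Z _ this)
  have hcX : Cov (X' : Set R) ((X' : Set R) - (X' : Set R)) 1 := by
    obtain ⟨x0, hx0⟩ := hXne
    exact ⟨{x0}, by simp, fun x hx => ⟨x0, by simp, x, hx, x0, hx0, rfl⟩⟩
  have hcZ := hg.cardZ
  rw [Set.ncard_coe_finset] at hcZ
  obtain ⟨hf1, hk1⟩ := (hg.sub2 hcT hcX).card hZfin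
  obtain ⟨hf2, hk2⟩ := (hg.add2 hcT hcX).card hZfin
  have hk1' : ((T : Set R) - (X' : Set R)).ncard ≤ M1 * L * L * X'.card := by
    refine hk1.trans ?_
    rw [mul_one, mul_assoc (M1 * L)]
    exact Nat.mul_le_mul_left _ hcZ
  have hk2' : ((T : Set R) + (X' : Set R)).ncard ≤ M1 * L * L * X'.card := by
    refine hk2.trans ?_
    rw [mul_one, mul_assoc (M1 * L)]
    exact Nat.mul_le_mul_left _ hcZ
  obtain ⟨D, hDne, hDc, hDD⟩ := exists_D T X' hXne (M1 * L * L) _ hf1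
    (fun t ht x hx => ⟨t, ht, x, hx, rfl⟩) hk1'
  obtain ⟨X2, hs2, hne2, hc2, J, hJT, hJ, hJu⟩ := hM R T ((X' : Set R) - (X' : Set R)) X1 D symm_sub hne1 hDne hDc
    hd1 hDD hTst (by
      refine (coset_count T X1 _ hf2 (fun t ht x hx => ⟨t, ht, x, hs hx, rfl⟩)).trans ?_
      refine hk2'.trans ?_
      calc M1 * L * L * X'.card ≤ M1 * L * L * (N * X1.card) := Nat.mul_le_mul_left _ hcard1
        _ ≤ _ := by rw [← mul_assoc]; exact Nat.mul_le_mul_right _ (by omega))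
    (fun x hx y hy => (hmul0 _ (hd1 x hx y hy)).2.mono
      (Set.mul_subset_mul_left (by exact_mod_cast hs)) subset_rfl (by omega))
  refine ⟨X2, by exact_mod_cast hs2.trans hs, hne2, ?_, J, hJT, hJ, hJu⟩
  rw [Set.ncard_coe_finset, mul_assoc]
  exact hcard1.trans (Nat.mul_le_mul_left _ hc2)

end part8

section part9

lemma dyadic {R : Type u} [NonUnitalRing R] {X : Set R} {L : ℕ} (hg : Good X L) (X2 : Finset R)
    (hX2 : (X2 : Set R) ⊆ X) (hne : X2.Nonempty) (s : ℕ) :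
    ∃ X3 ⊆ X2, X3.Nonempty ∧ X2.card ≤ L ^ s * X3.card ∧ ∃ c : R,
      (∀ x ∈ X3, 2 ^ s • x - c ∈ X - X) ∧
      ∀ i ≤ s, ∀ x ∈ X3, ∀ y ∈ X3, 2 ^ i • (x - y) ∈ (X - X) + (X - X) := by
  induction s with
  | zero =>
    obtain ⟨x0, hx0⟩ := hne
    refine ⟨X2, subset_rfl, ⟨x0, hx0⟩, by simp, x0, fun x hx => ?_, fun i hi x hx y hy => ?_⟩
    · rw [pow_zero, one_smul]; exact ⟨x, hX2 hx, x0, hX2 hx0, rfl⟩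
    · obtain rfl : i = 0 := by omega
      rw [pow_zero, one_smul]
      exact ⟨x - y, ⟨x, hX2 hx, y, hX2 hy, rfl⟩, 0, hg.zero, by simp⟩
  | succ s ih =>
    obtain ⟨X3, hs, hne3, hc, c, h1, h2⟩ := ih
    obtain ⟨X4, hs4, hne4, hc4, f, hf⟩ := pigeon1 X3 hne3 (fun x => 2 ^ (s + 1) • x - (c + c)) (X - X) L
      (hg.addc.mono (by
        rintro _ ⟨x, hx, rfl⟩
        refine ⟨_, h1 x hx, _, h1 x hx, ?_⟩
        simp only [pow_succ, mul_two, add_smul]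
        abel) subset_rfl le_rfl)
    refine ⟨X4, hs4.trans hs, hne4, ?_, c + c + f, fun x hx => ?_, fun i hi x hx y hy => ?_⟩
    · rw [pow_succ, mul_assoc]
      exact hc.trans (Nat.mul_le_mul_left _ hc4)
    · rw [← sub_sub]; exact hf x hx
    · rcases Nat.lt_or_ge s i with h | h
      · obtain rfl : i = s + 1 := by omega
        rw [← subZ_eq]
        refine ⟨_, hf x hx, _, hf y hy, ?_⟩
        simp only [smul_sub]
        abel
      · exact h2 i h x (hs4 hx) y (hs4 hy)

section ring
variable {R : Type u} [NonUnitalRing R]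

lemma mulIter_mul (B : Set R) (i k : ℕ) {a b : R} (ha : a ∈ mulIter B i) (hb : b ∈ mulIter B k) :
    a * b ∈ mulIter B (i + k + 1) := by
  induction k generalizing b with
  | zero => exact ⟨a, ha, b, hb, rfl⟩
  | succ k ih =>
    obtain ⟨c, hc, d, hd, rfl⟩ := hb
    exact ⟨a * c, ih hc, d, hd, by simp [mul_assoc]⟩

/-- additive span of the products of at least `j+1` elements of `B` -/
def spn (B : Set R) (j : ℕ) : AddSubgroup R :=
  AddSubgroup.closure {r | ∃ i, j ≤ i ∧ r ∈ mulIter B i}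

lemma spn_anti (B : Set R) {i j : ℕ} (h : i ≤ j) : spn B j ≤ spn B i :=
  AddSubgroup.closure_mono (by rintro r ⟨k, hk, hr⟩; exact ⟨k, h.trans hk, hr⟩)

lemma spn_mul (B : Set R) (j : ℕ) {a b : R} (ha : a ∈ spn B j) (hb : b ∈ spn B 0) :
    a * b ∈ spn B (j + 1) := by
  unfold spn at ha hb
  refine AddSubgroup.closure_induction (p := fun a _ => a * b ∈ spn B (j + 1)) ?_ ?_ ?_ ?_ ha
  · rintro a ⟨i, hi, hai⟩
    refine AddSubgroup.closure_induction (p := fun b _ => a * b ∈ spn B (j + 1)) ?_ ?_ ?_ ?_ hb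
    · rintro b ⟨k, hk, hbk⟩
      exact AddSubgroup.subset_closure ⟨i + k + 1, by omega, mulIter_mul B i k hai hbk⟩
    · rw [mul_zero]; exact zero_mem _
    · intro x y _ _ hx hy; rw [mul_add]; exact add_mem hx hy
    · intro x _ hx; rw [mul_neg]; exact neg_mem hx
  · rw [zero_mul]; exact zero_mem _
  · intro x y _ _ hx hy; rw [add_mul]; exact add_mem hx hy
  · intro x _ hx; rw [neg_mul]; exact neg_mem hx

lemma spn_sub (B : Set R) : B ⊆ spn B 0 := fun b hb =>
  AddSubgroup.subset_closure ⟨0, le_rfl, hb⟩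

lemma spn_ring (B : Set R) : IsSubringSet (spn B 0 : Set R) :=
  ⟨zero_mem _, fun _ hx _ hy => add_mem hx hy, fun _ hx => neg_mem hx,
    fun _ hx _ hy => spn_anti B (Nat.zero_le 1) (spn_mul B 0 hx hy)⟩

lemma mulIter_spn (B : Set R) (j : ℕ) : mulIter (spn B 0 : Set R) j ⊆ spn B j := by
  induction j with
  | zero => exact subset_rfl
  | succ j ih =>
    rintro _ ⟨a, ha, b, hb, rfl⟩
    exact spn_mul B j (ih ha) hb

lemma spn_act (B : Set R) (J : AddSubgroup R) (h : ∀ b ∈ B, ∀ t ∈ J, b * t ∈ J ∧ t * b ∈ J)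
    {r : R} (hr : r ∈ spn B 0) : ∀ t ∈ J, r * t ∈ J ∧ t * r ∈ J := by
  unfold spn at hr
  refine AddSubgroup.closure_induction (p := fun r _ => ∀ t ∈ J, r * t ∈ J ∧ t * r ∈ J) ?_ ?_ ?_ ?_ hr
  · rintro r ⟨i, -, hi⟩
    induction i generalizing r with
    | zero => exact h r hi
    | succ i ih =>
      obtain ⟨a, ha, b, hb, rfl⟩ := hi
      intro t ht
      simp only
      refine ⟨?_, ?_⟩
      · rw [mul_assoc]; exact (ih a ha _ (h b hb t ht).1).1
      · rw [← mul_assoc]; exact (h b hb _ (ih a ha t ht).2).2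
  · intro t _; simp
  · intro x y _ _ hx hy t ht
    rw [add_mul, mul_add]
    exact ⟨add_mem (hx t ht).1 (hy t ht).1, add_mem (hx t ht).2 (hy t ht).2⟩
  · intro x _ hx t ht
    rw [neg_mul, mul_neg]
    exact ⟨neg_mem (hx t ht).1, neg_mem (hx t ht).2⟩

lemma spn_le (B : Set R) (J : AddSubgroup R) (m : ℕ)
    (h : ∀ b ∈ B, ∀ t ∈ J, b * t ∈ J ∧ t * b ∈ J) (hm : mulIter B m ⊆ J) : spn B m ≤ J := by
  refine (AddSubgroup.closure_le _).2 ?_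
  rintro r ⟨i, hi, hr⟩
  obtain ⟨k, rfl⟩ := Nat.exists_eq_add_of_le hi
  clear hi
  induction k generalizing r with
  | zero => exact hm hr
  | succ k ih =>
    obtain ⟨a, ha, b, hb, rfl⟩ := hr
    exact (h b hb _ (ih ha)).2

lemma prod_dyadic {Z B : Set R} (h0 : (0 : R) ∈ Z) (s : ℕ)
    (hB : ∀ i ≤ s, ∀ b ∈ B, 2 ^ i • b ∈ Z + Z) (j : ℕ) :
    ∀ c ∈ mulIter B j, ∀ i ≤ s * (j + 1), 2 ^ i • c ∈ iterX Z (j + 1) := by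
  have h1 : ∀ i ≤ s, ∀ b ∈ B, 2 ^ i • b ∈ iterX Z 1 := fun i hi b hb => by
    obtain ⟨x, hx, y, hy, h⟩ := hB i hi b hb
    rw [← h]; exact iterX_add h0 0 hx hy
  induction j with
  | zero => exact fun c hc i hi => h1 i (by omega) c hc
  | succ j ih =>
    rintro _ ⟨c, hc, b, hb, rfl⟩ i hi
    have : ∃ i1 i2, i1 ≤ s * (j + 1) ∧ i2 ≤ s ∧ i = i1 + i2 := by
      rcases le_total i (s * (j + 1)) with h | h
      · exact ⟨i, 0, h, by omega, rfl⟩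
      · refine ⟨s * (j + 1), i - s * (j + 1), le_rfl, ?_, by omega⟩
        have : s * (j + 1 + 1) = s * (j + 1) + s := by ring
        omega
    obtain ⟨i1, i2, hi1, hi2, rfl⟩ := this
    have e : (2 : ℕ) ^ (i1 + i2) • (c * b) = (2 ^ i1 • c) * (2 ^ i2 • b) := by
      rw [pow_add, smul_mul_smul_comm]
    simp only
    rw [e]
    exact iterX_mul h0 (j + 1) (ih c hc i1 hi1) (iterX_mono h0 (by omega) (h1 i2 hi2 b hb))

end ring

lemma numA (q L c : ℕ) (hq : 1 ≤ q) : ∃ J : ℕ, ∀ s n : ℕ, J ≤ s → n ≤ 2 ^ (q * (s + 1)) →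
    (((s * (8 * q)) ^ L * (c * n) : ℕ) : ℝ) < (3 / 2) ^ (s * (8 * q)) := by
  obtain ⟨J, hJ⟩ := poly_lt_exp (8 * q) 0 L ((c : ℝ) * 2 ^ q) 2 (by positivity) (by norm_num)
  refine ⟨J, fun s n hs hn => ?_⟩
  have h := hJ s hs
  have hn' : (n : ℝ) ≤ 2 ^ (q * (s + 1)) := by exact_mod_cast hn
  have e1 : (2 : ℝ) ^ (q * (s + 1)) = 2 ^ q * 2 ^ (q * s) := by rw [← pow_add]; congr 1; ring
  have e2 : (2 : ℝ) ^ s * 2 ^ (q * s) ≤ (3 / 2) ^ (s * (8 * q)) := by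
    calc (2 : ℝ) ^ s * 2 ^ (q * s) = 2 ^ (s + q * s) := (pow_add _ _ _).symm
      _ ≤ 2 ^ (4 * (s * q)) := by
          apply pow_le_pow_right₀ (by norm_num)
          nlinarith
      _ = (2 ^ 4) ^ (s * q) := pow_mul _ _ _
      _ ≤ ((3 / 2) ^ 8) ^ (s * q) := by gcongr; norm_num
      _ = _ := by rw [← pow_mul]; congr 1; ring
  calc (((s * (8 * q)) ^ L * (c * n) : ℕ) : ℝ)
      = ((8 * q * s + 0 : ℕ) : ℝ) ^ L * (c * n) := by
        push_cast; rw [add_zero]; congr 2; ring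
    _ ≤ ((8 * q * s + 0 : ℕ) : ℝ) ^ L * (c * (2 ^ q * 2 ^ (q * s))) := by
        rw [← e1]; gcongr
    _ = ((c : ℝ) * 2 ^ q * ((8 * q * s + 0 : ℕ) : ℝ) ^ L) * 2 ^ (q * s) := by ring
    _ < 2 ^ s * 2 ^ (q * s) := by gcongr
    _ ≤ _ := e2

lemma numB (ε : ℝ) (hε : 0 < ε) (p q M : ℕ) (hq : 1 ≤ q) (hpq : 2 * p ≤ ε * q) :
    ∃ N : ℕ, ∀ n s b L : ℕ, N ≤ n → 1 ≤ n → L ≤ 2 ^ p → 2 ^ (q * s) ≤ n → n ≤ M * (L ^ s * b) →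
      (n : ℝ) ^ (1 - ε) ≤ b := by
  refine ⟨⌈(M : ℝ) ^ (2 / ε)⌉₊, fun n s b L hN hn hL hs hb => ?_⟩
  have hn0 : (0 : ℝ) < n := by exact_mod_cast hn
  have hn1 : (1 : ℝ) ≤ n := by exact_mod_cast hn
  have hM : (M : ℝ) ≤ (n : ℝ) ^ (ε / 2) := by
    have h1 : (M : ℝ) ^ (2 / ε) ≤ n := Nat.ceil_le.1 hN
    have h2 := Real.rpow_le_rpow (by positivity) h1 (show 0 ≤ ε / 2 by positivity)
    rw [← Real.rpow_mul (by positivity)] at h2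
    have : 2 / ε * (ε / 2) = 1 := by field_simp
    rwa [this, Real.rpow_one] at h2
  have hq0 : (0 : ℝ) < q := by exact_mod_cast hq
  have hLs : ((L : ℝ)) ^ s ≤ (n : ℝ) ^ (ε / 2) := by
    have hs' : (2 : ℝ) ^ (q * s) ≤ n := by exact_mod_cast hs
    have hL' : (L : ℝ) ≤ 2 ^ p := by exact_mod_cast hL
    calc (L : ℝ) ^ s ≤ (2 ^ p) ^ s := by gcongr
      _ = ((2 : ℝ) ^ (q * s)) ^ ((p : ℝ) / q) := by
          rw [← Real.rpow_natCast 2 (q * s), ← Real.rpow_mul (by norm_num), ← pow_mul,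
            ← Real.rpow_natCast]
          congr 1
          push_cast
          field_simp
      _ ≤ (n : ℝ) ^ ((p : ℝ) / q) := Real.rpow_le_rpow (by positivity) hs' (by positivity)
      _ ≤ (n : ℝ) ^ (ε / 2) := by
          apply Real.rpow_le_rpow_of_exponent_le hn1
          rw [div_le_div_iff₀ hq0 (by norm_num)]
          linarith
  have hb' : (n : ℝ) ≤ M * (L ^ s * b) := by exact_mod_cast hb
  have h3 : (n : ℝ) ≤ (n : ℝ) ^ ε * b := by
    calc (n : ℝ) ≤ M * (L ^ s * b) := hb'
      _ ≤ (n : ℝ) ^ (ε / 2) * ((n : ℝ) ^ (ε / 2) * b) := by gcongr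
      _ = _ := by rw [← mul_assoc, ← Real.rpow_add hn0]; congr 2; ring
  rw [Real.rpow_sub hn0, Real.rpow_one, div_le_iff₀ (by positivity)]
  linarith

theorem mainK (ε : ℝ) (hε : 0 < ε) (K : ℕ) : ∃ N0 : ℕ, ∀ (R : Type u) [NonUnitalRing R] (X : Set R),
    X.Finite → X.Nonempty → N0 ≤ X.ncard → (X + X + X * X).ncard ≤ K * X.ncard →
    ∃ R' I : Set R, IsSubringSet R' ∧ IsTwoSidedIdealIn I R' ∧
      I ⊆ R' ∩ (((X - X) + (X - X) + (X - X) + (X - X)) +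
          (X - X) * ((X - X) + (X - X) + (X - X) + (X - X))) ∧
      I ⊆ R' ∩ iterX (X - X) 3 ∧
      (∃ m : ℕ, mulIter R' m ⊆ I) ∧
      (X.ncard : ℝ) ^ ((1 : ℝ) - ε) ≤ ((iterX (X - X) 3 ∩ R').ncard : ℝ) := by
  obtain ⟨L0, hL0⟩ : ∃ L0, L0 = K ^ 5 := ⟨_, rfl⟩
  obtain ⟨p, hp⟩ : ∃ p : ℕ, L0 ≤ 2 ^ p := ⟨L0, Nat.lt_two_pow_self.le⟩
  obtain ⟨q, hq1, hq2⟩ : ∃ q : ℕ, 1 ≤ q ∧ 2 * (p : ℝ) ≤ ε * q := by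
    refine ⟨⌈2 * (p : ℝ) / ε⌉₊ + 1, by omega, ?_⟩
    have := Nat.le_ceil (2 * (p : ℝ) / ε)
    rw [div_le_iff₀ hε] at this
    push_cast
    nlinarith
  obtain ⟨m, hm⟩ : ∃ m, m + 1 = 8 * q := ⟨8 * q - 1, by omega⟩
  obtain ⟨L, hL⟩ := iter_cov.{u} L0 (m + 5)
  obtain ⟨k0, hk0⟩ := orbit.{u} L
  obtain ⟨κ, hκ⟩ := exists_T.{u} L (k0 + 1)
  obtain ⟨M, hM⟩ := step5.{u} L0 (m + 4 + κ)
  obtain ⟨J1, hJ1⟩ := numA q L (L * L0) hq1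
  obtain ⟨N1, hN1⟩ := numB ε hε p q M hq1 hq2
  refine ⟨N1 + 2 ^ (q * (J1 + 1)), ?_⟩
  intro R _ X hX hne hcard hsmall
  have hg : Good X L0 := hL0 ▸ good_of_small hX hne hsmall
  have h0 := hg.zero
  have hZfin : (X - X).Finite := hX.sub hX
  obtain ⟨Y, hY⟩ : ∃ Y, Y = iterX (X - X) (m + 4) := ⟨_, rfl⟩
  have hZY : X - X ⊆ Y := by rw [hY]; exact iterX_mono h0 (Nat.zero_le _)
  have hYf : Y.Finite := hY ▸ iterX_finite hZfin _
  have hY0 : (0 : R) ∈ Y := hZY h0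
  have hYs : ∀ y ∈ Y, -y ∈ Y := by rw [hY]; exact iterX_neg symm_sub _
  have hcovn := (hL R X hg).1
  have hYY : Cov (Y + Y) Y L := by
    refine hcovn.mono ?_ hZY le_rfl
    rintro _ ⟨a, ha, b, hb, rfl⟩
    rw [hY] at ha hb
    exact iterX_add h0 _ ha hb
  have hYcard : Y.ncard ≤ L * L0 * X.ncard := by
    have h1 : Cov Y (X - X) L := hcovn.mono (by rw [hY]; exact iterX_mono h0 (by omega)) subset_rfl le_rfl
    refine (h1.card hZfin).2.trans ?_
    rw [mul_assoc]
    exact Nat.mul_le_mul_left _ hg.cardZ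
  obtain ⟨T, hTs, hTmax⟩ := hκ R Y hYf hY0 hYs hYY
  obtain ⟨X2, hX2, hne2, hc2, J, hJT, hJ, hJu⟩ := hM R X hg T
    (hTs.trans (by rw [hY]; exact ms_iterX h0 _ _))
    (fun H hH => hTmax H (hH.trans (by
      refine Set.Subset.trans ?_ (ms_mono hY0 (show 1 ≤ k0 + 1 by omega))
      rw [ms_one, hY]; exact iterX_mono h0 (by omega))))
  obtain ⟨n, hn⟩ : ∃ n, n = X.ncard := ⟨_, rfl⟩
  rw [← hn] at hcard hYcard hc2 ⊢
  have hnpos : 1 ≤ n := hn ▸ (Set.ncard_pos hX).2 hne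
  obtain ⟨s, hs⟩ : ∃ s, s = Nat.log 2 n / q := ⟨_, rfl⟩
  have hs1 : 2 ^ (q * s) ≤ n := by
    refine (Nat.pow_le_pow_right (by norm_num) ?_).trans (Nat.pow_log_le_self 2 (by omega))
    rw [hs]; exact Nat.mul_div_le _ _
  have hs2 : n ≤ 2 ^ (q * (s + 1)) := by
    refine (Nat.lt_pow_succ_log_self (by norm_num : 1 < 2) n).le.trans
      (Nat.pow_le_pow_right (by norm_num) ?_)
    rw [hs]
    have := Nat.lt_mul_div_succ (Nat.log 2 n) (show 0 < q by omega)
    omega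
  have hsJ : J1 + 1 ≤ s := by
    rw [hs, Nat.le_div_iff_mul_le (by omega)]
    refine Nat.le_log_of_pow_le (by norm_num) ?_
    rw [mul_comm]
    omega
  obtain ⟨X3, hs3, hne3, hc3, -, -, hdy⟩ := dyadic hg X2 hX2 hne2 s
  obtain ⟨x0, hx0⟩ := hne3
  obtain ⟨B, hB⟩ : ∃ B : Set R, B = (fun x => x - x0) '' (X3 : Set R) := ⟨_, rfl⟩
  have hBcard : B.ncard = X3.card := by
    rw [hB, Set.ncard_image_of_injective _ sub_left_injective, Set.ncard_coe_finset]
  have hBZ : B ⊆ X - X := by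
    rw [hB]; rintro _ ⟨x, hx, rfl⟩
    exact ⟨x, hX2 (hs3 hx), x0, hX2 (hs3 hx0), rfl⟩
  have hBJ : ∀ b ∈ B, ∀ t ∈ T, b * t ∈ J ∧ t * b ∈ J := by
    rw [hB]; rintro _ ⟨x, hx, rfl⟩
    exact hJ x (hs3 hx) x0 (hs3 hx0)
  have hBJ' : ∀ b ∈ B, ∀ t ∈ J, b * t ∈ J ∧ t * b ∈ J := fun b hb t ht => hBJ b hb t (hJT ht)
  have hBT : mulIter B m ⊆ T := by
    intro c hc
    have h1 := prod_dyadic (B := B) h0 s (by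
      rw [hB]; rintro i hi _ ⟨x, hx, rfl⟩
      exact hdy i hi x hx x0 hx0) m c hc
    rw [hm] at h1
    have h2 := hk0 R Y hYf hY0 hYs hYY c (s * (8 * q)) (fun i hi => by
      rw [hY]
      exact iterX_mono h0 (by omega) (h1 i hi)) (Nat.mul_pos (by omega) (by omega)) (by
        refine lt_of_le_of_lt ?_ (hJ1 s n (by omega) hs2)
        exact_mod_cast Nat.mul_le_mul_left _ hYcard)
    exact hTmax (AddSubgroup.zmultiples c) (h2.trans (ms_mono hY0 (by omega)))
      (AddSubgroup.mem_zmultiples c)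
  have hBm : mulIter B (m + 1) ⊆ J := by
    rintro _ ⟨c, hc, b, hb, rfl⟩
    exact (hBJ b hb c (hBT hc)).2
  have hZ2 : ∀ u ∈ (X - X) + (X - X) + (X - X) + (X - X), u ∈ iterX (X - X) 2 := by
    rintro _ ⟨_, ⟨_, ⟨a, ha, b, hb, rfl⟩, c, hc, rfl⟩, d, hd, rfl⟩
    simp only
    rw [add_assoc (a + b)]
    exact iterX_add h0 1 (iterX_add h0 0 ha hb) (iterX_add h0 0 hc hd)
  have hJ3 : ∀ u ∈ J, u ∈ iterX (X - X) 3 := by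
    intro u hu
    obtain ⟨a, ha, _, ⟨b, hb, c, hc, rfl⟩, rfl⟩ := hJu u hu
    exact ⟨a, ⟨a, hZ2 a ha, 0, iterX_zero_mem h0 2, by simp⟩, _,
      ⟨b, iterX_mono h0 (show 0 ≤ 2 by omega) hb, c, hZ2 c hc, rfl⟩, rfl⟩
  refine ⟨spn B 0, (J : Set R) ∩ spn B 0, spn_ring B, ?_, ?_, ?_, ⟨m + 1, ?_⟩, ?_⟩
  · refine ⟨Set.inter_subset_right, ⟨zero_mem _, zero_mem _⟩,
      fun x hx y hy => ⟨add_mem hx.1 hy.1, add_mem hx.2 hy.2⟩,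
      fun x hx => ⟨neg_mem hx.1, neg_mem hx.2⟩, fun r hr x hx => ?_⟩
    have h1 := spn_act B J hBJ' hr x hx.1
    exact ⟨⟨h1.1, (spn_ring B).2.2.2 r hr x hx.2⟩, ⟨h1.2, (spn_ring B).2.2.2 x hx.2 r hr⟩⟩
  · exact fun x hx => ⟨hx.2, hJu x hx.1⟩
  · exact fun x hx => ⟨hx.2, hJ3 x hx.1⟩
  · intro x hx
    have h1 := mulIter_spn B (m + 1) hx
    exact ⟨spn_le B J (m + 1) hBJ' hBm h1, spn_anti B (Nat.zero_le _) h1⟩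
  · have h1 : (n : ℝ) ^ (1 - ε) ≤ (X3.card : ℝ) := by
      refine hN1 n s X3.card L0 (le_trans (Nat.le_add_right _ _) hcard) hnpos hp hs1 ?_
      exact hc2.trans (Nat.mul_le_mul_left _ hc3)
    refine h1.trans ?_
    rw [← hBcard]
    have h2 : B ⊆ iterX (X - X) 3 ∩ (spn B 0 : Set R) := fun b hb =>
      ⟨iterX_mono h0 (Nat.zero_le 3) (hBZ hb), spn_sub B hb⟩
    exact_mod_cast Set.ncard_le_ncard h2 ((iterX_finite hZfin 3).inter_of_left _)

end part9

/-- Sum-product phenomenon in all rings with exponent `1 - ε`: there is a non-decreasing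
unbounded `f : ℕ → ℕ` such that for every finite nonempty subset `X` of a ring, with
`Z := X - X`, either `|X+X+X·X| ≥ f(|X|)·|X|`, or there are a subring `R'` and an ideal
`I ⊴ R'` with `I ⊆ R' ∩ (4Z + Z·4Z)` (hence `I ⊆ R' ∩ Z₃`), `R'/I` nilpotent, and
`|Z₃ ∩ R'| ≥ |X|^{1-ε}`. -/
theorem stmt5 (ε : ℝ) (hε : 0 < ε) :
    ∃ f : ℕ → ℕ, Monotone f ∧ (∀ m : ℕ, ∃ n : ℕ, m ≤ f n) ∧
      ∀ (R : Type u) [NonUnitalRing R] (X : Set R), X.Finite → X.Nonempty →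
        f X.ncard * X.ncard ≤ (X + X + X * X).ncard ∨
        ∃ R' I : Set R, IsSubringSet R' ∧ IsTwoSidedIdealIn I R' ∧
          I ⊆ R' ∩ (((X - X) + (X - X) + (X - X) + (X - X)) +
              (X - X) * ((X - X) + (X - X) + (X - X) + (X - X))) ∧
          I ⊆ R' ∩ iterX (X - X) 3 ∧
          (∃ m : ℕ, mulIter R' m ⊆ I) ∧
          (X.ncard : ℝ) ^ ((1 : ℝ) - ε) ≤ ((iterX (X - X) 3 ∩ R').ncard : ℝ) := by
  classical
  choose N hN using mainK.{u} ε hε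
  let P : ℕ → ℕ → Prop := fun n K => ∀ K' ≤ K, K' = 0 ∨ N K' ≤ n
  have hP0 : ∀ n, P n 0 := fun n K' h => Or.inl (by omega)
  refine ⟨fun n => Nat.findGreatest (P n) n, ?_, ?_, ?_⟩
  · intro a b hab
    refine Nat.le_findGreatest ((Nat.findGreatest_le a).trans hab) ?_
    have h1 : P a (Nat.findGreatest (P a) a) := Nat.findGreatest_spec (Nat.zero_le a) (hP0 a)
    exact fun K' hK' => (h1 K' hK').imp_right fun h => h.trans hab
  · intro m
    refine ⟨m + ∑ K ∈ Finset.range (m + 1), N K, Nat.le_findGreatest (by omega) fun K' hK' => Or.inr ?_⟩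
    have := Finset.single_le_sum (f := N) (fun _ _ => Nat.zero_le _)
      (Finset.mem_range.2 (show K' < m + 1 by omega))
    omega
  · intro R _ X hX hne
    have h1 : P X.ncard (Nat.findGreatest (P X.ncard) X.ncard) :=
      Nat.findGreatest_spec (Nat.zero_le _) (hP0 _)
    rcases h1 _ le_rfl with h | h
    · left
      simp only
      rw [h, zero_mul]
      exact Nat.zero_le _
    · by_cases h2 : Nat.findGreatest (P X.ncard) X.ncard * X.ncard ≤ (X + X + X * X).ncard
      · exact Or.inl h2
      · exact Or.inr (hN _ R X hX hne h (by omega))
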